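/- arXiv:math/0612292 — 5 statements merged into one kernel-verified Lean document; each statement's English description precedes it below -/
import Mathlib

section
/- The alternating group A_6 has exactly four table automorphisms; that is, the set of pairs (σ, τ) that are table automorphisms of A_6 has exactly four elements. -/
/-- `f : G → ℂ` is an irreducible character of `G` if it is the character of some
irreducible (simple) finite-dimensional complex representation of `G`. -/
def IsIrrChar (G : Type) [Group G] (f : G → ℂ) : Prop :=
  ∃ V : FDRep ℂ G, CategoryTheory.Simple V ∧ f = V.character

/-- `(σ, τ)` is a table automorphism of `G`: `σ` permutes the irreducible characters,
`τ` permutes the conjugacy classes, and for every irreducible character `f`, every `g`,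
and every `h` whose conjugacy class is `τ` of the class of `g`, `(σ f) h = f g`. -/
def IsTableAut (G : Type) [Group G]
    (σ : Equiv.Perm {f : G → ℂ // IsIrrChar G f})
    (τ : Equiv.Perm (ConjClasses G)) : Prop :=
  ∀ (f : {f : G → ℂ // IsIrrChar G f}) (g h : G),
    ConjClasses.mk h = τ (ConjClasses.mk g) → (σ f).1 h = f.1 g

open scoped MonoidAlgebra

namespace Representation

variable {G V : Type} [Group G] [AddCommGroup V] [Module ℂ V] [FiniteDimensional ℂ V]

theorem isIrrChar_character [Finite G] (ρ : Representation ℂ G V) [ρ.IsIrreducible] :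
    IsIrrChar G ρ.character := by
  classical
  have := Fintype.ofFinite G
  have hc : (Nat.card G : ℂ) ≠ 0 := Nat.cast_ne_zero.mpr Nat.card_pos.ne'
  have := invertibleOfNonzero hc
  refine ⟨FDRep.of ρ, ?_, rfl⟩
  rw [FDRep.simple_iff_char_is_norm_one]
  have h := char_orthonormal ρ ρ
  rw [if_pos ⟨Equiv.refl ρ⟩, inv_mul_eq_one₀ hc] at h
  exact h.symm

/-- Schur's lemma: a class function orthogonal to the character of an irreducible
representation acts on that representation by zero. -/
theorem sum_smul_eq_zero_of_orthogonal [Fintype G] (ρ : Representation ℂ G V) [ρ.IsIrreducible]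
    {b : G → ℂ} (hb : ∀ x y, b (x * y * x⁻¹) = b y)
    (h : ∑ y, b y * ρ.character y⁻¹ = 0) : ∑ y, b y • ρ y⁻¹ = 0 := by
  let T : IntertwiningMap ρ ρ :=
    { toLinearMap := ∑ y, b y • ρ y⁻¹
      isIntertwining' := fun g => by
        simp only [← Module.End.mul_eq_comp, Finset.sum_mul, Finset.mul_sum]
        refine (Fintype.sum_equiv (MulAut.conj g⁻¹).toEquiv _ _ fun y => ?_)
        simp only [smul_mul_assoc, mul_smul_comm, MulEquiv.toEquiv_eq_coe,
          MulEquiv.coe_toEquiv, MulAut.conj_apply, hb, ← map_mul]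
        congr 2
        group }
  obtain ⟨c, hc⟩ :=
    (IsIrreducible.algebraMap_intertwiningMap_bijective_of_isAlgClosed (ρ := ρ)).2 T
  have hc' : ∑ y, b y • ρ y⁻¹ = c • LinearMap.id := by
    change T.toLinearMap = _
    rw [← hc]
    ext v
    simp [Algebra.algebraMap_eq_smul_one]
  have ht := congrArg (LinearMap.trace ℂ V) hc'
  rw [map_sum] at ht
  simp only [map_smul, smul_eq_mul, LinearMap.trace_id] at ht
  change ∑ y, b y * ρ.character y⁻¹ = _ at ht
  have : Nontrivial V := IsSimpleModule.nontrivial ℂ[G] ρ.asModule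
  have hd : (Module.finrank ℂ V : ℂ) ≠ 0 := Nat.cast_ne_zero.mpr Module.finrank_pos.ne'
  rw [h, eq_comm, mul_eq_zero, or_iff_left hd] at ht
  rw [hc', ht, zero_smul]

end Representation

section Characters

theorem IsIrrChar.map_conj {G : Type} [Group G] {f : G → ℂ} (hf : IsIrrChar G f) (x y : G) :
    f (x * y * x⁻¹) = f y := by
  obtain ⟨V, -, rfl⟩ := hf
  simp

variable {G : Type} [Group G] [Fintype G]

theorem sum_single_smul_eq_zero_of_orthogonal {M : Type} [AddCommGroup M] [Module ℂ M]
    [Module ℂ[G] M] [IsScalarTower ℂ ℂ[G] M] [IsSimpleModule ℂ[G] M]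
    {b : G → ℂ} (hb : ∀ x y, b (x * y * x⁻¹) = b y)
    (h : ∀ f, IsIrrChar G f → ∑ y, b y * f y⁻¹ = 0) (m : M) :
    (∑ y, MonoidAlgebra.single y⁻¹ (b y)) • m = 0 := by
  let ρ : Representation ℂ G M := Representation.ofModule' M
  have hρ : ρ.asAlgebraHom = Algebra.lsmul ℂ ℂ M :=
    (MonoidAlgebra.lift ℂ (Module.End ℂ M) G).apply_symm_apply _
  let e : ρ.asModule ≃ₗ[ℂ[G]] M :=
    { ρ.asModuleEquiv with
      map_smul' := fun r x => by
        change ρ.asModuleEquiv (r • x) = r • ρ.asModuleEquiv x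
        rw [ρ.asModuleEquiv_map_smul, hρ, Algebra.lsmul_coe] }
  have : ρ.IsIrreducible :=
    ρ.irreducible_iff_isSimpleModule_asModule.mpr (IsSimpleModule.congr e)
  have : FiniteDimensional ℂ M := Module.Finite.trans ℂ[G] M
  have h0 := ρ.sum_smul_eq_zero_of_orthogonal hb (h _ ρ.isIrrChar_character)
  have hz : ρ.asAlgebraHom (∑ y, MonoidAlgebra.single y⁻¹ (b y)) = 0 := by
    rw [← h0]
    simp [map_sum, Representation.asAlgebraHom_single]
  rw [hρ] at hz
  exact congrArg (fun T => T m) hz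

/-- A class function orthogonal to all irreducible characters vanishes. -/
theorem eq_zero_of_orthogonal_isIrrChar {b : G → ℂ} (hb : ∀ x y, b (x * y * x⁻¹) = b y)
    (h : ∀ f, IsIrrChar G f → ∑ y, b y * f y⁻¹ = 0) : b = 0 := by
  have : NeZero (Nat.card G : ℂ) := ⟨Nat.cast_ne_zero.mpr Nat.card_pos.ne'⟩
  have hz : ∑ y, MonoidAlgebra.single y⁻¹ (b y) ∈ Ring.jacobson (ℂ[G]) := by
    rw [Ring.jacobson_eq_sInf_isMaximal, Submodule.mem_sInf]
    intro m hm
    have : IsSimpleModule (ℂ[G]) (ℂ[G] ⧸ m) :=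
      isSimpleModule_iff_isCoatom.mpr (Ideal.isMaximal_def.mp hm)
    have h1 := sum_single_smul_eq_zero_of_orthogonal hb h (Submodule.Quotient.mk (p := m) 1)
    rwa [← Submodule.Quotient.mk_smul, Submodule.Quotient.mk_eq_zero, smul_eq_mul, mul_one] at h1
  rw [IsSemisimpleRing.jacobson_eq_bot, Submodule.mem_bot] at hz
  classical
  funext y
  have := congrArg (fun w : ℂ[G] => w.coeff y⁻¹) hz
  simpa [MonoidAlgebra.coeff_single, Finsupp.single_apply, Finsupp.finsetSum_apply] using this

theorem IsIrrChar.sum_mul_inv [DecidableEq (G → ℂ)] {f f' : G → ℂ} (hf : IsIrrChar G f)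
    (hf' : IsIrrChar G f') :
    ∑ y, f y * f' y⁻¹ = if f = f' then (Fintype.card G : ℂ) else 0 := by
  classical
  have hc : (Nat.card G : ℂ) ≠ 0 := Nat.cast_ne_zero.mpr Nat.card_pos.ne'
  have := invertibleOfNonzero hc
  obtain ⟨V, hV, rfl⟩ := hf
  obtain ⟨W, hW, rfl⟩ := hf'
  split_ifs with h
  · rw [← h, (FDRep.simple_iff_char_is_norm_one V).mp hV, Nat.card_eq_fintype_card]
  · have := FDRep.char_orthonormal V W
    rw [if_neg fun ⟨i⟩ => h (FDRep.char_iso i)] at this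
    simpa [hc] using this

instance finite_isIrrChar : Finite {f : G → ℂ // IsIrrChar G f} := by
  classical
  refine LinearIndependent.finite (R := ℂ) (f := fun f : {f : G → ℂ // IsIrrChar G f} => f.1) ?_
  rw [linearIndependent_iff']
  intro s c hs f hf
  have := congrArg (fun F : G → ℂ => ∑ y, F y * f.1 y⁻¹) hs
  simp only [Finset.sum_apply, Pi.smul_apply, smul_eq_mul, Finset.sum_mul, mul_assoc,
    Pi.zero_apply, zero_mul, Finset.sum_const_zero] at this
  rw [Finset.sum_comm] at this
  simp only [← Finset.mul_sum, fun g : {f : G → ℂ // IsIrrChar G f} => g.2.sum_mul_inv f.2,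
    Subtype.coe_inj] at this
  simpa [hf] using this

/-- Column orthogonality for irreducible characters. -/
theorem sum_isIrrChar_mul [DecidableEq G] [Fintype {f : G → ℂ // IsIrrChar G f}] (g h : G) :
    ∑ f : {f : G → ℂ // IsIrrChar G f}, f.1 g * f.1 h =
      (Finset.univ.filter fun x : G => x * g⁻¹ = h * x).card := by
  classical
  let a : G → ℂ := fun y => ∑ x : G, if x * g⁻¹ * x⁻¹ = y then 1 else 0
  let b : G → ℂ := fun y => ∑ f : {f : G → ℂ // IsIrrChar G f}, f.1 g * f.1 y - a y
  have hb : b = 0 := by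
    apply eq_zero_of_orthogonal_isIrrChar
    · intro u y
      simp only [b, a, fun f : {f : G → ℂ // IsIrrChar G f} => f.2.map_conj]
      congr 1
      refine (Fintype.sum_equiv (Equiv.mulLeft u) _ _ fun x => ?_).symm
      simp only [Equiv.coe_mulLeft, mul_inv_rev]
      refine if_congr ?_ rfl rfl
      rw [show u * x * g⁻¹ * (x⁻¹ * u⁻¹) = u * (x * g⁻¹ * x⁻¹) * u⁻¹ by group]
      simp
    · intro φ hφ
      simp only [b, a, sub_mul, Finset.sum_sub_distrib, Finset.sum_mul, mul_assoc]
      rw [Finset.sum_comm, sub_eq_zero, Finset.sum_comm (s := Finset.univ (α := G))]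
      simp only [← Finset.mul_sum, fun f : {f : G → ℂ // IsIrrChar G f} => f.2.sum_mul_inv hφ]
      rw [Finset.sum_eq_single ⟨φ, hφ⟩ (by
        rintro f - hf
        rw [if_neg fun e => hf (Subtype.ext e), mul_zero]) (by simp)]
      simp [hφ.map_conj, mul_comm (φ g)]
  have := congrFun hb h
  simp only [b, a, Pi.zero_apply, sub_eq_zero] at this
  rw [this, Finset.sum_boole]
  simp only [mul_inv_eq_iff_eq_mul]

end Characters

section TableAutomorphisms

variable {G : Type} [Group G]

/-- The permutation of the conjugacy classes induced by a group automorphism. -/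
def conjClassesPerm : MulAut G →* Equiv.Perm (ConjClasses G) where
  toFun α :=
    { toFun := ConjClasses.map α.toMonoidHom
      invFun := ConjClasses.map α.symm.toMonoidHom
      left_inv := by rintro ⟨g⟩; exact congrArg ConjClasses.mk (α.symm_apply_apply g)
      right_inv := by rintro ⟨g⟩; exact congrArg ConjClasses.mk (α.apply_symm_apply g) }
  map_one' := by ext ⟨g⟩; rfl
  map_mul' α β := by ext ⟨g⟩; rfl

@[simp]
theorem conjClassesPerm_mk (α : MulAut G) (g : G) :
    conjClassesPerm α (ConjClasses.mk g) = ConjClasses.mk (α g) := rfl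

theorem IsIrrChar.comp_mulAut [Finite G] {f : G → ℂ} (hf : IsIrrChar G f) (α : MulAut G) :
    IsIrrChar G (f ∘ α) := by
  have := Fintype.ofFinite G
  obtain ⟨V, hV, rfl⟩ := hf
  refine ⟨FDRep.of (V.ρ.comp α.toMonoidHom), ?_, rfl⟩
  rw [FDRep.simple_iff_char_is_norm_one] at hV ⊢
  rw [← hV]
  refine Fintype.sum_equiv α.toEquiv _ _ fun g => ?_
  change V.character (α g) * V.character (α g⁻¹) = V.character (α g) * V.character (α g)⁻¹
  rw [map_inv]

/-- A group automorphism induces a table automorphism. -/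
theorem exists_isTableAut_conjClassesPerm [Finite G] (α : MulAut G) :
    ∃ σ, IsTableAut G σ (conjClassesPerm α) := by
  refine ⟨⟨fun f => ⟨f.1 ∘ ⇑(α⁻¹), f.2.comp_mulAut _⟩, fun f => ⟨f.1 ∘ α, f.2.comp_mulAut _⟩,
    fun f => ?_, fun f => ?_⟩, fun f g h hgh => ?_⟩
  · ext x; simp
  · ext x; simp
  · rw [conjClassesPerm_mk, ConjClasses.mk_eq_mk_iff_isConj, isConj_comm, isConj_iff] at hgh
    obtain ⟨x, rfl⟩ := hgh
    change f.1 (α⁻¹ (x * α g * x⁻¹)) = f.1 g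
    simp [f.2.map_conj]

theorem IsTableAut.left_unique {σ σ' : Equiv.Perm {f : G → ℂ // IsIrrChar G f}}
    {τ : Equiv.Perm (ConjClasses G)} (h : IsTableAut G σ τ) (h' : IsTableAut G σ' τ) :
    σ = σ' := by
  ext f y
  obtain ⟨g, hg⟩ := ConjClasses.mk_surjective (τ.symm (ConjClasses.mk y))
  have hy : ConjClasses.mk y = τ (ConjClasses.mk g) := by simp [hg]
  rw [h f g y hy, h' f g y hy]

theorem IsTableAut.card_eq [Fintype G] [DecidableEq G]
    {σ : Equiv.Perm {f : G → ℂ // IsIrrChar G f}} {τ : Equiv.Perm (ConjClasses G)}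
    (hτ : IsTableAut G σ τ) {g h : G} (hgh : τ (ConjClasses.mk g) = ConjClasses.mk h) :
    (Finset.univ.filter fun x : G => x * g⁻¹ = g * x).card =
      (Finset.univ.filter fun x : G => x * h⁻¹ = h * x).card := by
  have := Fintype.ofFinite {f : G → ℂ // IsIrrChar G f}
  rw [← Nat.cast_inj (R := ℂ), ← sum_isIrrChar_mul, ← sum_isIrrChar_mul]
  refine Fintype.sum_equiv σ _ _ fun f => ?_
  rw [hτ f g h hgh.symm]

end TableAutomorphisms

namespace AlternatingGroupSix

open Equiv

/-- Representatives of the conjugacy classes of `A₆`, of cycle types `1`, `2²`, `3`, `3²`,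
`4·2`, `5`, `5`. -/
def rep (i : Fin 7) : alternatingGroup (Fin 6) :=
  ⟨![1, swap 0 1 * swap 2 3, swap 0 1 * swap 1 2, swap 0 1 * swap 1 2 * (swap 3 4 * swap 4 5),
    swap 0 1 * swap 1 2 * swap 2 3 * swap 4 5, swap 0 1 * swap 1 2 * swap 2 3 * swap 3 4,
    swap 0 2 * swap 2 1 * swap 1 3 * swap 3 4] i, by
    rw [Perm.mem_alternatingGroup]
    revert i
    decide⟩

/-- The orders of the centralizers of the representatives. -/
def centralizerCard : Fin 7 → ℕ := ![360, 8, 9, 9, 4, 5, 5]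

theorem card_commute_rep : ∀ i,
    (Finset.univ.filter fun x => x * rep i = rep i * x).card = centralizerCard i := by
  decide +kernel

theorem card_mul_inv_rep : ∀ i,
    (Finset.univ.filter fun x => x * (rep i)⁻¹ = rep i * x).card = centralizerCard i := by
  decide +kernel

theorem not_isConj_rep_three : ∀ x, x * rep 2 ≠ rep 3 * x := by
  decide +kernel

theorem not_isConj_rep_five : ∀ x, x * rep 5 ≠ rep 6 * x := by
  decide +kernel

/-- The class of a representative. -/
def cls (i : Fin 7) : ConjClasses (alternatingGroup (Fin 6)) := ConjClasses.mk (rep i)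

theorem card_commute_congr {G : Type*} [Group G] [Fintype G] [DecidableEq G] {g h : G}
    (hgh : IsConj g h) :
    (Finset.univ.filter fun x : G => x * g = g * x).card =
      (Finset.univ.filter fun x : G => x * h = h * x).card := by
  obtain ⟨c, rfl⟩ := isConj_iff.mp hgh
  refine Finset.card_equiv (MulAut.conj c).toEquiv fun x => ?_
  simp

theorem cls_injective : Function.Injective cls := by
  have h23 : cls 2 ≠ cls 3 := fun h => by
    obtain ⟨x, hx⟩ := isConj_iff.mp (ConjClasses.mk_eq_mk_iff_isConj.mp h)
    exact not_isConj_rep_three x (mul_inv_eq_iff_eq_mul.mp hx)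
  have h56 : cls 5 ≠ cls 6 := fun h => by
    obtain ⟨x, hx⟩ := isConj_iff.mp (ConjClasses.mk_eq_mk_iff_isConj.mp h)
    exact not_isConj_rep_five x (mul_inv_eq_iff_eq_mul.mp hx)
  intro i j hij
  have h := card_commute_congr (ConjClasses.mk_eq_mk_iff_isConj.mp hij)
  rw [card_commute_rep, card_commute_rep] at h
  have key : ∀ i j, centralizerCard i = centralizerCard j → i = j ∨ (i = 2 ∧ j = 3) ∨
      (i = 3 ∧ j = 2) ∨ (i = 5 ∧ j = 6) ∨ (i = 6 ∧ j = 5) := by decide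
  rcases key i j h with h | ⟨rfl, rfl⟩ | ⟨rfl, rfl⟩ | ⟨rfl, rfl⟩ | ⟨rfl, rfl⟩
  · exact h
  · exact (h23 hij).elim
  · exact (h23 hij.symm).elim
  · exact (h56 hij).elim
  · exact (h56 hij.symm).elim

theorem card_alternatingGroup_six : Fintype.card (alternatingGroup (Fin 6)) = 360 := by
  rw [← Nat.card_eq_fintype_card, nat_card_alternatingGroup, Nat.card_eq_fintype_card,
    Fintype.card_fin]
  rfl

theorem ncard_carrier_cls (i : Fin 7) : (cls i).carrier.ncard = 360 / centralizerCard i := by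
  classical
  rw [← Nat.card_coe_set_eq, Nat.card_eq_fintype_card, cls, ConjClasses.card_carrier,
    card_alternatingGroup_six, ← card_commute_rep, Fintype.card_subtype]
  congr 1
  refine Finset.card_equiv ConjAct.ofConjAct.toEquiv fun x => ?_
  simp [ConjAct.smul_def, mul_inv_eq_iff_eq_mul]

theorem cls_surjective : Function.Surjective cls := by
  classical
  by_contra hs
  simp only [Function.Surjective, not_forall, not_exists] at hs
  obtain ⟨c, hc⟩ := hs
  have := Fintype.ofFinite (ConjClasses (alternatingGroup (Fin 6)))
  have hsum := Group.sum_card_conj_classes_eq_card (alternatingGroup (Fin 6))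
  rw [finsum_eq_sum_of_fintype, Nat.card_eq_fintype_card, card_alternatingGroup_six] at hsum
  have hle := Finset.sum_le_univ_sum_of_nonneg
    (f := fun x : ConjClasses (alternatingGroup (Fin 6)) => x.carrier.ncard)
    (s := insert c (Finset.univ.image cls)) (fun _ => Nat.zero_le _)
  rw [hsum, Finset.sum_insert (by simpa using hc),
    Finset.sum_image (cls_injective.injOn)] at hle
  simp only [ncard_carrier_cls] at hle
  have h360 : ∑ i, 360 / centralizerCard i = 360 := by decide
  rw [h360] at hle
  have hpos : 0 < c.carrier.ncard := by
    obtain ⟨g, rfl⟩ := ConjClasses.mk_surjective c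
    exact (Set.ncard_pos).2 ⟨g, ConjClasses.mem_carrier_mk⟩
  omega

/-- The fixed-point-free involution `(a b)(c d)(e f)`. -/
def syntheme (a b c d e f : Fin 6) : Perm (Fin 6) := swap a b * swap c d * swap e f

/-- The five synthemes, viewed as involutions, in each of the six synthematic totals. -/
def totalSynthemes : Fin 6 → Fin 5 → Perm (Fin 6) :=
  ![![syntheme 0 1 2 3 4 5, syntheme 0 2 1 4 3 5, syntheme 0 3 1 5 2 4,
      syntheme 0 4 1 3 2 5, syntheme 0 5 1 2 3 4],
    ![syntheme 0 1 2 3 4 5, syntheme 0 2 1 5 3 4, syntheme 0 3 1 4 2 5,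
      syntheme 0 4 1 2 3 5, syntheme 0 5 1 3 2 4],
    ![syntheme 0 1 2 4 3 5, syntheme 0 2 1 3 4 5, syntheme 0 3 1 4 2 5,
      syntheme 0 4 1 5 2 3, syntheme 0 5 1 2 3 4],
    ![syntheme 0 1 2 4 3 5, syntheme 0 2 1 5 3 4, syntheme 0 3 1 2 4 5,
      syntheme 0 4 1 3 2 5, syntheme 0 5 1 4 2 3],
    ![syntheme 0 1 2 5 3 4, syntheme 0 2 1 3 4 5, syntheme 0 3 1 5 2 4,
      syntheme 0 4 1 2 3 5, syntheme 0 5 1 4 2 3],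
    ![syntheme 0 1 2 5 3 4, syntheme 0 2 1 4 3 5, syntheme 0 3 1 2 4 5,
      syntheme 0 4 1 5 2 3, syntheme 0 5 1 3 2 4]]

/-- The synthematic totals, as sets of involutions. -/
def total (k : Fin 6) : Set (Perm (Fin 6)) := Set.range (totalSynthemes k)

theorem totalSynthemes_separated :
    ∀ k l, (∀ m, ∃ n, totalSynthemes l n = totalSynthemes k m) → k = l := by
  decide +kernel

theorem total_injective : Function.Injective total := fun k l h =>
  totalSynthemes_separated k l fun m => by
    have hm : totalSynthemes k m ∈ total k := ⟨m, rfl⟩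
    rwa [h] at hm

/-- Conjugation of sets of permutations. -/
def conjSet : Perm (Fin 6) →* Perm (Set (Perm (Fin 6))) where
  toFun g := Equiv.Set.congr (MulAut.conj g).toEquiv
  map_one' := by ext1; simp
  map_mul' g h := by
    ext1 s
    simp [Set.image_image, mul_assoc]

theorem conjSet_apply (g : Perm (Fin 6)) (s : Set (Perm (Fin 6))) :
    conjSet g s = (fun x => g * x * g⁻¹) '' s := rfl

theorem swap_mul_totalSynthemes : ∀ i j k, ∃ l,
    (∀ m, ∃ n, totalSynthemes l n * swap i j = swap i j * totalSynthemes k m) ∧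
    (∀ n, ∃ m, swap i j * totalSynthemes k m = totalSynthemes l n * swap i j) := by
  decide +kernel

theorem conjSet_swap_total (i j k : Fin 6) : ∃ l, total l = conjSet (swap i j) (total k) := by
  obtain ⟨l, h₁, h₂⟩ := swap_mul_totalSynthemes i j k
  refine ⟨l, ?_⟩
  rw [conjSet_apply, total, total, ← Set.range_comp]
  apply subset_antisymm
  · rintro _ ⟨n, rfl⟩
    obtain ⟨m, hm⟩ := h₂ n
    exact ⟨m, mul_inv_eq_iff_eq_mul.mpr hm⟩
  · rintro _ ⟨m, rfl⟩
    obtain ⟨n, hn⟩ := h₁ m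
    exact ⟨n, eq_mul_inv_iff_mul_eq.mpr hn⟩

theorem conjSet_mem_range_total (g : Perm (Fin 6)) :
    ∀ t ∈ Set.range total, conjSet g t ∈ Set.range total := by
  induction g using Perm.swap_induction_on with
  | one => simp
  | swap_mul g i j _ ih =>
    intro t ht
    rw [map_mul]
    obtain ⟨k, hk⟩ := ih t ht
    rw [Perm.mul_apply, ← hk]
    exact conjSet_swap_total i j k

/-- The action of `S₆` on the six synthematic totals. -/
def totalsHom : Perm (Fin 6) →* Perm (Set.range total) where
  toFun g := ⟨fun t => ⟨conjSet g t, conjSet_mem_range_total g t t.2⟩,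
    fun t => ⟨conjSet g⁻¹ t, conjSet_mem_range_total g⁻¹ t t.2⟩,
    fun t => by ext1; simp, fun t => by ext1; simp⟩
  map_one' := by ext1; simp
  map_mul' g h := by ext1; simp

theorem rep_two_mul_totalSynthemes_ne : ∀ k, ∃ m, ∀ n,
    totalSynthemes k n * rep 2 ≠ rep 2 * totalSynthemes k m := by
  decide +kernel

theorem conjSet_rep_two_total_ne (k : Fin 6) : conjSet (rep 2) (total k) ≠ total k := by
  intro h
  obtain ⟨m, hm⟩ := rep_two_mul_totalSynthemes_ne k
  have hmem : (rep 2 : Perm (Fin 6)) * totalSynthemes k m * (rep 2 : Perm (Fin 6))⁻¹ ∈ total k := by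
    rw [← h, conjSet_apply]
    exact Set.mem_image_of_mem _ (Set.mem_range_self m)
  obtain ⟨n, hn⟩ := hmem
  exact hm n (eq_mul_inv_iff_mul_eq.mp hn)

/-- The numbering of the synthematic totals. -/
noncomputable def totalsEquiv : Set.range total ≃ Fin 6 :=
  (Equiv.ofInjective total total_injective).symm

/-- The exotic endomorphism of `S₆`. -/
noncomputable def exoticHom : Perm (Fin 6) →* Perm (Fin 6) :=
  totalsEquiv.permCongrHom.toMonoidHom.comp totalsHom

theorem exoticHom_rep_two_ne (i : Fin 6) : exoticHom (rep 2) i ≠ i := by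
  intro h
  obtain ⟨k, hk⟩ := (totalsEquiv.symm i).2
  apply conjSet_rep_two_total_ne k
  rw [hk]
  have h' : totalsHom (rep 2) (totalsEquiv.symm i) = totalsEquiv.symm i := by
    rw [Equiv.eq_symm_apply]
    exact h
  exact congrArg Subtype.val h'

theorem exoticHom_mem_alternatingGroup {g : Perm (Fin 6)} (hg : g ∈ alternatingGroup (Fin 6)) :
    exoticHom g ∈ alternatingGroup (Fin 6) := by
  rw [← Perm.closure_three_cycles_eq_alternating] at hg
  have hle : Subgroup.closure {σ : Perm (Fin 6) | σ.IsThreeCycle} ≤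
      (alternatingGroup (Fin 6)).comap exoticHom := by
    rw [Subgroup.closure_le]
    intro σ hσ
    have h3 : (Perm.sign (exoticHom σ)) ^ 3 = 1 := by
      rw [← map_pow, ← map_pow, ← Perm.IsThreeCycle.orderOf hσ, pow_orderOf_eq_one, map_one,
        map_one]
    rcases Int.units_eq_one_or (Perm.sign (exoticHom σ)) with h | h
    · exact h
    · rw [h] at h3
      exact absurd h3 (by decide)
  exact hle hg

/-- An automorphism of `A₆` exchanging the two classes of elements of order three. -/
theorem exists_exotic_mulAut :
    ∃ α : MulAut (alternatingGroup (Fin 6)), conjClassesPerm α (cls 2) ≠ cls 2 := by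
  let φ : alternatingGroup (Fin 6) →* alternatingGroup (Fin 6) :=
    (exoticHom.comp (alternatingGroup (Fin 6)).subtype).codRestrict _
      fun g => exoticHom_mem_alternatingGroup g.2
  have hφ : ∀ g, (φ g : Perm (Fin 6)) = exoticHom g := fun _ => rfl
  have : IsSimpleGroup (alternatingGroup (Fin 6)) := alternatingGroup.isSimpleGroup (by simp)
  have hker : φ.ker = ⊥ := by
    refine (IsSimpleGroup.eq_bot_or_eq_top_of_normal φ.ker inferInstance).resolve_right ?_
    intro htop
    have h1 : φ (rep 2) = 1 := φ.mem_ker.mp (htop ▸ Subgroup.mem_top _)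
    apply exoticHom_rep_two_ne 0
    rw [← hφ, h1]
    rfl
  have hbij : Function.Bijective φ :=
    Finite.injective_iff_bijective.mp ((MonoidHom.ker_eq_bot_iff φ).mp hker)
  refine ⟨MulEquiv.ofBijective φ hbij, fun h => ?_⟩
  rw [cls, conjClassesPerm_mk, ConjClasses.mk_eq_mk_iff_isConj, isConj_comm, isConj_iff] at h
  obtain ⟨x, hx⟩ := h
  apply exoticHom_rep_two_ne ((x : Perm (Fin 6)) 3)
  rw [← hφ]
  have hx' : (φ (rep 2) : Perm (Fin 6)) = x * rep 2 * (x : Perm (Fin 6))⁻¹ :=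
    congrArg Subtype.val hx.symm
  have h3 : (rep 2 : Perm (Fin 6)) 3 = 3 := by decide
  simp [hx', h3]

/-- Conjugation by an odd permutation exchanges the two classes of elements of order five. -/
theorem exists_swap_mulAut : ∃ α : MulAut (alternatingGroup (Fin 6)),
    conjClassesPerm α (cls 2) = cls 2 ∧ conjClassesPerm α (cls 5) = cls 6 := by
  refine ⟨MulAut.conjNormal (swap 1 2), ?_, ?_⟩
  · rw [cls, conjClassesPerm_mk, ConjClasses.mk_eq_mk_iff_isConj, isConj_iff]
    refine ⟨⟨swap 1 2 * swap 4 5, by rw [Perm.mem_alternatingGroup]; decide⟩, ?_⟩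
    ext1
    simp only [Subgroup.coe_mul, Subgroup.coe_inv, MulAut.conjNormal_apply]
    decide
  · rw [cls, conjClassesPerm_mk, cls]
    congr 1
    ext1
    rw [MulAut.conjNormal_apply]
    decide

section Classification

variable {τ τ' : Perm (ConjClasses (alternatingGroup (Fin 6)))}

theorem exists_apply_cls (h : ∃ σ, IsTableAut _ σ τ) (i : Fin 7) :
    ∃ j, τ (cls i) = cls j ∧ centralizerCard i = centralizerCard j := by
  obtain ⟨σ, h⟩ := h
  obtain ⟨j, hj⟩ := cls_surjective (τ (cls i))
  refine ⟨j, hj.symm, ?_⟩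
  rw [← card_mul_inv_rep, ← card_mul_inv_rep]
  exact h.card_eq hj.symm

theorem apply_cls_of_unique (h : ∃ σ, IsTableAut _ σ τ) {i : Fin 7}
    (hi : ∀ j, centralizerCard i = centralizerCard j → j = i) : τ (cls i) = cls i := by
  obtain ⟨j, hj, hij⟩ := exists_apply_cls h i
  rw [hj, hi j hij]

theorem apply_cls_of_pair (h : ∃ σ, IsTableAut _ σ τ) {i k : Fin 7}
    (hi : ∀ j, centralizerCard i = centralizerCard j → j = i ∨ j = k) :
    τ (cls i) = cls i ∨ τ (cls i) = cls k := by
  obtain ⟨j, hj, hij⟩ := exists_apply_cls h i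
  rcases hi j hij with rfl | rfl
  · exact Or.inl hj
  · exact Or.inr hj

theorem apply_two (h : ∃ σ, IsTableAut _ σ τ) : τ (cls 2) = cls 2 ∨ τ (cls 2) = cls 3 :=
  apply_cls_of_pair h (by decide)

theorem apply_five (h : ∃ σ, IsTableAut _ σ τ) : τ (cls 5) = cls 5 ∨ τ (cls 5) = cls 6 :=
  apply_cls_of_pair h (by decide)

theorem apply_partner_eq {i k : Fin 7} (hik : i ≠ k)
    (hk : τ (cls k) = cls k ∨ τ (cls k) = cls i)
    (h' : τ' (cls i) = cls i ∨ τ' (cls i) = cls k)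
    (hk' : τ' (cls k) = cls k ∨ τ' (cls k) = cls i)
    (e : τ (cls i) = τ' (cls i)) : τ (cls k) = τ' (cls k) := by
  have hc : cls i ≠ cls k := cls_injective.ne hik
  have hτ : τ (cls i) ≠ τ (cls k) := τ.injective.ne hc
  have hτ' : τ' (cls i) ≠ τ' (cls k) := τ'.injective.ne hc
  grind

/-- A table automorphism of `A₆` is determined by the images of one class of elements of order
three and one class of elements of order five. -/
theorem tableAut_ext (h : ∃ σ, IsTableAut _ σ τ) (h' : ∃ σ, IsTableAut _ σ τ')
    (h2 : τ (cls 2) = τ' (cls 2)) (h5 : τ (cls 5) = τ' (cls 5)) : τ = τ' := by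
  ext c
  obtain ⟨i, rfl⟩ := cls_surjective c
  fin_cases i
  · exact (apply_cls_of_unique h (by decide)).trans (apply_cls_of_unique h' (by decide)).symm
  · exact (apply_cls_of_unique h (by decide)).trans (apply_cls_of_unique h' (by decide)).symm
  · exact h2
  · exact apply_partner_eq (by decide) (apply_cls_of_pair h (by decide))
      (apply_two h') (apply_cls_of_pair h' (by decide)) h2
  · exact (apply_cls_of_unique h (by decide)).trans (apply_cls_of_unique h' (by decide)).symm
  · exact h5
  · exact apply_partner_eq (by decide) (apply_cls_of_pair h (by decide))
      (apply_five h') (apply_cls_of_pair h' (by decide)) h5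

end Classification

theorem setOf_isTableAut_eq {α β : MulAut (alternatingGroup (Fin 6))}
    (hα2 : conjClassesPerm α (cls 2) = cls 2) (hα5 : conjClassesPerm α (cls 5) = cls 6)
    (hβ2 : conjClassesPerm β (cls 2) = cls 3) :
    {τ | ∃ σ, IsTableAut (alternatingGroup (Fin 6)) σ τ} =
      {conjClassesPerm 1, conjClassesPerm α, conjClassesPerm β, conjClassesPerm (α * β)} := by
  have hα3 : conjClassesPerm α (cls 3) = cls 3 :=
    (apply_cls_of_pair (i := 3) (k := 2) (exists_isTableAut_conjClassesPerm α)
      (by decide)).resolve_right fun h => absurd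
        (cls_injective ((conjClassesPerm α).injective (hα2.trans h.symm))) (by decide)
  have hα6 : conjClassesPerm α (cls 6) = cls 5 :=
    (apply_cls_of_pair (i := 6) (k := 5) (exists_isTableAut_conjClassesPerm α)
      (by decide)).resolve_left fun h => absurd
        (cls_injective ((conjClassesPerm α).injective (hα5.trans h.symm))) (by decide)
  have hext : ∀ {τ : Perm (ConjClasses (alternatingGroup (Fin 6)))},
      (∃ σ, IsTableAut (alternatingGroup (Fin 6)) σ τ) → ∀ γ : MulAut _,
      τ (cls 2) = conjClassesPerm γ (cls 2) → τ (cls 5) = conjClassesPerm γ (cls 5) →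
        τ = conjClassesPerm γ :=
    fun h γ => tableAut_ext h (exists_isTableAut_conjClassesPerm γ)
  ext τ
  simp only [Set.mem_ofPred_eq, Set.mem_insert_iff, Set.mem_singleton_iff]
  constructor
  · intro h
    rcases apply_two h with h2 | h2 <;> rcases apply_five h with h5 | h5
    · exact Or.inl (hext h 1 (by simp [h2]) (by simp [h5]))
    · exact Or.inr (Or.inl (hext h α (by rw [h2, hα2]) (by rw [h5, hα5])))
    all_goals
      right; right
      rcases apply_five (exists_isTableAut_conjClassesPerm β) with hβ5 | hβ5
    · exact Or.inl (hext h β (by rw [h2, hβ2]) (by rw [h5, hβ5]))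
    · exact Or.inr (hext h (α * β) (by simp [h2, hβ2, hα3]) (by simp [h5, hβ5, hα6]))
    · exact Or.inr (hext h (α * β) (by simp [h2, hβ2, hα3]) (by simp [h5, hβ5, hα5]))
    · exact Or.inl (hext h β (by rw [h2, hβ2]) (by rw [h5, hβ5]))
  · rintro (rfl | rfl | rfl | rfl) <;> exact exists_isTableAut_conjClassesPerm _

theorem ncard_setOf_isTableAut :
    {τ | ∃ σ, IsTableAut (alternatingGroup (Fin 6)) σ τ}.ncard = 4 := by
  classical
  obtain ⟨α, hα2, hα5⟩ := exists_swap_mulAut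
  obtain ⟨β, hβ⟩ := exists_exotic_mulAut
  have hβ2 := (apply_two (exists_isTableAut_conjClassesPerm β)).resolve_left hβ
  rw [setOf_isTableAut_eq hα2 hα5 hβ2, map_one, map_mul]
  have hα1 : conjClassesPerm α ≠ 1 := fun h => by
    rw [h] at hα5
    exact absurd (cls_injective hα5) (by decide)
  have hβ1 : conjClassesPerm β ≠ 1 := fun h => hβ (by rw [h]; rfl)
  have hαβ : conjClassesPerm α ≠ conjClassesPerm β := fun h => hβ (by rw [← h, hα2])
  have hαβ1 : conjClassesPerm α * conjClassesPerm β ≠ 1 := fun h => hβ <| by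
    apply (conjClassesPerm α).injective
    rw [← Perm.mul_apply, h, hα2]
    rfl
  rw [Set.ncard_insert_of_notMem, Set.ncard_insert_of_notMem, Set.ncard_pair]
  · simpa using hα1
  · simp only [Set.mem_insert_iff, Set.mem_singleton_iff, left_eq_mul, not_or]
    exact ⟨hαβ, hβ1⟩
  · simp only [Set.mem_insert_iff, Set.mem_singleton_iff, not_or]
    exact ⟨hα1.symm, hβ1.symm, hαβ1.symm⟩

end AlternatingGroupSix

theorem table_auts_A6_card_four :
    Set.ncard {p : Equiv.Perm {f : alternatingGroup (Fin 6) → ℂ //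
        IsIrrChar (alternatingGroup (Fin 6)) f} ×
        Equiv.Perm (ConjClasses (alternatingGroup (Fin 6))) |
        IsTableAut (alternatingGroup (Fin 6)) p.1 p.2} = 4 := by
  have himage : Prod.snd '' {p : Equiv.Perm {f : alternatingGroup (Fin 6) → ℂ //
        IsIrrChar (alternatingGroup (Fin 6)) f} ×
        Equiv.Perm (ConjClasses (alternatingGroup (Fin 6))) |
        IsTableAut (alternatingGroup (Fin 6)) p.1 p.2} =
      {τ | ∃ σ, IsTableAut (alternatingGroup (Fin 6)) σ τ} := by
    ext τ
    simp
  rw [← AlternatingGroupSix.ncard_setOf_isTableAut, ← himage, Set.InjOn.ncard_image]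
  rintro ⟨σ, τ⟩ h ⟨σ', τ'⟩ h' (rfl : τ = τ')
  exact Prod.ext (h.left_unique h') rfl
end

section
/- Let n be a natural number with n ≠ 4. If (σ, τ) is a table automorphism of the symmetric group S_n, then τ preserves element orders: for every g ∈ S_n and every h ∈ S_n whose conjugacy class equals τ(conjugacy class of g), the order of h equals the order of g. -/
open Module Equiv

section Characters

lemma IsIrrChar.conj {G : Type} [Group G] {f : G → ℂ} (hf : IsIrrChar G f) (g k : G) :
    f (k * g * k⁻¹) = f g := by
  obtain ⟨V, _, rfl⟩ := hf
  exact V.char_conj g k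

variable {G : Type} [Group G] [Fintype G]

/-- Schur's lemma for a simple object of `FDRep ℂ G`. -/
lemma FDRep.exists_eq_smul_one_of_commute (V : FDRep ℂ G) [CategoryTheory.Simple V]
    (z : V →ₗ[ℂ] V) (hz : ∀ g, z ∘ₗ V.ρ g = V.ρ g ∘ₗ z) :
    ∃ c : ℂ, z = c • LinearMap.id := by
  have hcard : Invertible (Nat.card G : ℂ) :=
    invertibleOfNonzero (by exact_mod_cast Nat.card_pos.ne')
  have h1 : finrank ℂ (Representation.IntertwiningMap V.ρ V.ρ) = 1 := by
    have h2 := FDRep.char_orthonormal V V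
    rw [if_pos ⟨CategoryTheory.Iso.refl V⟩] at h2
    have h3 := Representation.card_inv_mul_sum_char_mul_char_eq_finrank V.ρ V.ρ
    have h4 : ((finrank ℂ (Representation.IntertwiningMap V.ρ V.ρ) : ℕ) : ℂ) = 1 :=
      h3.symm.trans h2
    exact_mod_cast h4
  have hne : (Representation.IntertwiningMap.id V.ρ) ≠ 0 := by
    intro h0
    have hz : ∀ f : Representation.IntertwiningMap V.ρ V.ρ, f = 0 := by
      intro f
      ext v
      have : (Representation.IntertwiningMap.id V.ρ) v = 0 := by rw [h0]; rfl
      have hv : v = 0 := this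
      simp [hv]
    have : Subsingleton (Representation.IntertwiningMap V.ρ V.ρ) :=
      ⟨fun a b => (hz a).trans (hz b).symm⟩
    rw [finrank_zero_of_subsingleton] at h1
    exact zero_ne_one h1
  obtain ⟨c, hc⟩ := (finrank_eq_one_iff_of_nonzero' _ hne).mp h1 ⟨z, hz⟩
  refine ⟨c, ?_⟩
  ext v
  have := congrArg (fun f : Representation.IntertwiningMap V.ρ V.ρ => f v) hc
  exact this.symm

lemma Representation.isIrrChar_character_s6 {V : Type} [AddCommGroup V] [Module ℂ V]
    [FiniteDimensional ℂ V] (ρ : Representation ℂ G V) [ρ.IsIrreducible] :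
    IsIrrChar G ρ.character := by
  have hcard : Invertible (Nat.card G : ℂ) :=
    invertibleOfNonzero (by exact_mod_cast Nat.card_pos.ne')
  refine ⟨FDRep.of ρ, ?_, rfl⟩
  rw [FDRep.simple_iff_char_is_norm_one]
  have h := Representation.char_orthonormal ρ ρ
  rw [if_pos ⟨Representation.Equiv.refl ρ⟩] at h
  have h5 : (Nat.card G : ℂ) ≠ 0 := by exact_mod_cast Nat.card_pos.ne'
  rw [inv_mul_eq_one₀ h5] at h
  exact h.symm

lemma Representation.sum_smul_eq_zero_of_simple (V : FDRep ℂ G) [CategoryTheory.Simple V]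
    (a : G → ℂ) (ha : ∀ g k, a (k * g * k⁻¹) = a g) (h : ∑ g, a g * V.character g = 0) :
    ∑ g, a g • V.ρ g = 0 := by
  obtain ⟨c, hc⟩ := V.exists_eq_smul_one_of_commute (∑ g, a g • V.ρ g) (by
    intro k
    have : (∑ g, a g • V.ρ g) * V.ρ k = V.ρ k * (∑ g, a g • V.ρ g) := by
      rw [Finset.sum_mul, Finset.mul_sum]
      refine (Fintype.sum_equiv (MulAut.conj k).toEquiv _ _ ?_).symm
      intro g
      simp [ha, ← map_mul]
    exact this)
  have ht : LinearMap.trace ℂ V (∑ g, a g • V.ρ g) = 0 := by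
    simpa [FDRep.character] using h
  rw [hc] at ht ⊢
  rw [map_smul, LinearMap.trace_id, smul_eq_mul, mul_eq_zero] at ht
  rcases ht with h0 | h0
  · simp [h0]
  · have : finrank ℂ V = 0 := by exact_mod_cast h0
    have := finrank_zero_iff.mp this
    ext v
    exact Subsingleton.elim _ _

lemma Representation.sum_smul_eq_zero
    (a : G → ℂ) (ha : ∀ g k, a (k * g * k⁻¹) = a g)
    (h : ∀ f, IsIrrChar G f → ∑ g, a g * f g = 0) (d : ℕ) :
    ∀ (V : Type) [AddCommGroup V] [Module ℂ V] [FiniteDimensional ℂ V]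
      (ρ : Representation ℂ G V), finrank ℂ V = d → ∑ g, a g • ρ g = 0 := by
  induction d using Nat.strong_induction_on with
  | _ d ih =>
  intro V _ _ _ ρ hd
  by_cases hirr : ρ.IsIrreducible
  · obtain ⟨W, hW, hf⟩ := ρ.isIrrChar_character_s6
    have hsimp : CategoryTheory.Simple (FDRep.of ρ) := by
      rw [FDRep.simple_iff_char_is_norm_one] at hW ⊢
      rw [← hW, ← hf]
      rfl
    exact Representation.sum_smul_eq_zero_of_simple (FDRep.of ρ) a ha (h _ ⟨_, hsimp, rfl⟩)
  · have hss : ρ.IsSemisimpleRepresentation := by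
      rw [Representation.isSemisimpleRepresentation_iff_isSemisimpleModule_asModule]
      have : NeZero (Nat.card G : ℂ) := ⟨by exact_mod_cast Nat.card_pos.ne'⟩
      infer_instance
    rcases subsingleton_or_nontrivial V with hV | hV
    · ext v
      exact Subsingleton.elim _ _
    have hnt : ∃ W : Subrepresentation ρ, W ≠ ⊥ ∧ W ≠ ⊤ := by
      by_contra! hcon
      have : Nontrivial (Subrepresentation ρ) := by
        refine ⟨⊥, ⊤, fun hbt => ?_⟩
        have := congrArg Subrepresentation.toSubmodule hbt
        exact bot_ne_top (α := Submodule ℂ V) this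
      refine hirr ⟨fun W => ?_⟩
      by_cases hW : W = ⊥
      · exact Or.inl hW
      · exact Or.inr (hcon W hW)
    obtain ⟨W, hW0, hW1⟩ := hnt
    obtain ⟨W', hWW'⟩ := exists_isCompl W
    have key : ∀ U : Subrepresentation ρ, U ≠ ⊤ → ∀ v ∈ U.toSubmodule,
        (∑ g, a g • ρ g) v = 0 := by
      intro U hU v hv
      have hlt : U.toSubmodule < ⊤ := by
        rw [lt_top_iff_ne_top]
        intro h0
        exact hU (Subrepresentation.toSubmodule_injective h0)
      have := ih (finrank ℂ U.toSubmodule) (hd ▸ Submodule.finrank_lt hlt.ne) U.toSubmodule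
        U.toRepresentation rfl
      have h2 := congrArg (fun f => ((f ⟨v, hv⟩ : U.toSubmodule) : V)) this
      simp only [LinearMap.sum_apply, LinearMap.smul_apply, LinearMap.zero_apply,
        Submodule.coe_sum, Submodule.coe_smul, Submodule.coe_zero] at h2
      simp only [LinearMap.sum_apply, LinearMap.smul_apply]
      exact h2
    have hW'1 : W' ≠ ⊤ := by
      rintro rfl
      exact hW0 (by simpa using hWW'.inf_eq_bot)
    have hsup : W.toSubmodule ⊔ W'.toSubmodule = ⊤ := by
      rw [← Subrepresentation.toSubmodule_sup, hWW'.sup_eq_top]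
      rfl
    ext v
    obtain ⟨w, hw, w', hw', rfl⟩ :=
      Submodule.mem_sup.mp (hsup ▸ Submodule.mem_top : v ∈ W.toSubmodule ⊔ W'.toSubmodule)
    rw [map_add, key W hW1 w hw, key W' hW'1 w' hw']
    simp

/-- The irreducible characters span the space of class functions. -/
theorem mem_span_isIrrChar (φ : G → ℂ) (hφ : ∀ g k, φ (k * g * k⁻¹) = φ g) :
    φ ∈ Submodule.span ℂ {f | IsIrrChar G f} := by
  classical
  by_contra hmem
  obtain ⟨l, hl, hker⟩ := Submodule.exists_le_ker_of_notMem hmem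
  set b : G → ℂ := fun g => l (Pi.single g 1) with hb
  have hlb : ∀ f : G → ℂ, l f = ∑ g, b g * f g := by
    intro f
    conv_lhs => rw [← Finset.univ_sum_single f]
    rw [map_sum]
    refine Finset.sum_congr rfl fun g _ => ?_
    have : (Pi.single g (f g) : G → ℂ) = f g • Pi.single g 1 := by
      rw [← Pi.single_smul]; simp
    rw [this, map_smul, smul_eq_mul, mul_comm]
  set a : G → ℂ := fun g => ∑ k, b (k * g * k⁻¹) with ha
  have hainv : ∀ g k, a (k * g * k⁻¹) = a g := by
    intro g k
    refine Fintype.sum_equiv (Equiv.mulRight k) _ _ fun x => ?_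
    simp [mul_assoc]
  have hab : ∀ f : G → ℂ, (∀ g k, f (k * g * k⁻¹) = f g) →
      ∑ g, a g * f g = Fintype.card G * l f := by
    intro f hf
    simp only [ha, Finset.sum_mul]
    rw [Finset.sum_comm]
    have : ∀ k : G, ∑ g, b (k * g * k⁻¹) * f g = l f := by
      intro k
      rw [hlb]
      refine Fintype.sum_equiv (MulAut.conj k).toEquiv _ _ fun x => ?_
      simp [hf]
    simp [this]
  have hzero := Representation.sum_smul_eq_zero a hainv (by
    intro f hf
    have h0 : l f = 0 := hker (Submodule.subset_span hf)
    obtain ⟨V, hV, rfl⟩ := hf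
    rw [hab _ (fun g k => V.char_conj g k), h0, mul_zero]) _ (MonoidAlgebra ℂ G)
      (Representation.ofMulAction ℂ G G) rfl
  have ha0 : ∀ g, a g = 0 := by
    intro g
    have := congrArg (fun T => (T (MonoidAlgebra.single 1 1) : MonoidAlgebra ℂ G).coeff g) hzero
    simpa [LinearMap.sum_apply, Finsupp.single_apply] using this
  have := hab φ hφ
  simp only [ha0, zero_mul, Finset.sum_const_zero] at this
  rcases mul_eq_zero.mp this.symm with h | h
  · exact Fintype.card_ne_zero (by exact_mod_cast h)
  · exact hl h

lemma IsIrrChar.exists_one_eq_natCast {f : G → ℂ} (hf : IsIrrChar G f) :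
    ∃ m : ℕ, 0 < m ∧ f 1 = m := by
  obtain ⟨V, hV, rfl⟩ := hf
  refine ⟨finrank ℂ V, ?_, V.char_one⟩
  rw [Nat.pos_iff_ne_zero]
  intro h0
  have := finrank_zero_iff.mp h0
  have hn := (FDRep.simple_iff_char_is_norm_one V).mp hV
  have hz : ∀ g, V.character g = 0 := by
    intro g
    have : V.ρ g = 0 := by ext v; exact Subsingleton.elim _ _
    simp [FDRep.character, this]
  simp only [hz, zero_mul, Finset.sum_const_zero] at hn
  exact (Nat.card_pos (α := G)).ne' (by exact_mod_cast hn.symm)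

open scoped Classical in
lemma IsIrrChar.sum_eq {f : G → ℂ} (hf : IsIrrChar G f) :
    ∑ g, f g = if f = 1 then (Fintype.card G : ℂ) else 0 := by
  have hcard : Invertible (Nat.card G : ℂ) :=
    invertibleOfNonzero (by exact_mod_cast Nat.card_pos.ne')
  split_ifs with h1
  · simp [h1]
  · obtain ⟨V, hV, rfl⟩ := hf
    let W : FDRep ℂ G := FDRep.of (Representation.trivial ℂ G ℂ)
    have hWc : ∀ g, W.character g = 1 := by
      intro g
      change LinearMap.trace ℂ ℂ (Representation.trivial ℂ G ℂ g) = 1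
      have : Representation.trivial ℂ G ℂ g = LinearMap.id := by ext; simp
      rw [this, LinearMap.trace_id]; simp
    have hW : CategoryTheory.Simple W := by
      rw [FDRep.simple_iff_char_is_norm_one]
      simp [hWc]
    have := FDRep.char_orthonormal V W
    rw [if_neg] at this
    · simpa [hWc] using this
    · rintro ⟨i⟩
      apply h1
      rw [FDRep.char_iso i]
      ext g
      simp [hWc]

end Characters

section TableAutomorphisms

lemma IsConj.apply_eq_of_conj_invariant {G X : Type*} [Group G] {φ : G → X}
    (hφ : ∀ g k, φ (k * g * k⁻¹) = φ g) {a b : G} (h : IsConj a b) : φ a = φ b := by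
  obtain ⟨c, rfl⟩ := isConj_iff.mp h
  exact (hφ a c).symm

variable {G : Type} [Group G] {σ : Equiv.Perm {f : G → ℂ // IsIrrChar G f}}
  {τ : Equiv.Perm (ConjClasses G)} {t : G → G}

lemma IsTableAut.isIrrChar_comp (h : IsTableAut G σ τ)
    (ht : ∀ g, ConjClasses.mk (t g) = τ (ConjClasses.mk g)) {f : G → ℂ} (hf : IsIrrChar G f) :
    IsIrrChar G (f ∘ t) := by
  have : f ∘ t = (σ.symm ⟨f, hf⟩).1 := by
    ext g
    have := h (σ.symm ⟨f, hf⟩) g (t g) (ht g)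
    simpa using this
  rw [this]
  exact (σ.symm ⟨f, hf⟩).2

lemma isConj_lift_iff (ht : ∀ g, ConjClasses.mk (t g) = τ (ConjClasses.mk g)) {a b : G} :
    IsConj (t a) (t b) ↔ IsConj a b := by
  rw [← ConjClasses.mk_eq_mk_iff_isConj, ht, ht, τ.injective.eq_iff,
    ConjClasses.mk_eq_mk_iff_isConj]

variable [Fintype G]

lemma IsTableAut.sum_comp (h : IsTableAut G σ τ)
    (ht : ∀ g, ConjClasses.mk (t g) = τ (ConjClasses.mk g)) (φ : G → ℂ)
    (hφ : ∀ g k, φ (k * g * k⁻¹) = φ g) : ∑ g, φ (t g) = ∑ g, φ g := by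
  have hmem := mem_span_isIrrChar φ hφ
  clear hφ
  induction hmem using Submodule.span_induction with
  | mem f hf =>
    have hf' := h.isIrrChar_comp ht hf
    have h1 : f ∘ t = 1 ↔ f = 1 := by
      refine ⟨fun h1 => ?_, fun h1 => by rw [h1]; rfl⟩
      ext g
      obtain ⟨g', hg'⟩ := ConjClasses.mk_surjective (τ.symm (ConjClasses.mk g))
      have h2 : IsConj (t g') g := by
        rw [← ConjClasses.mk_eq_mk_iff_isConj, ht, hg', Equiv.apply_symm_apply]
      rw [← h2.apply_eq_of_conj_invariant (IsIrrChar.conj hf)]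
      exact congrFun h1 g'
    have h2 := hf'.sum_eq
    rw [hf.sum_eq]
    simp only [h1] at h2
    exact h2
  | zero => simp
  | add f f' _ _ h1 h2 => simp [Finset.sum_add_distrib, h1, h2]
  | smul c f _ h1 => simp [← Finset.mul_sum, h1]

lemma IsTableAut.card_isConj (h : IsTableAut G σ τ)
    (ht : ∀ g, ConjClasses.mk (t g) = τ (ConjClasses.mk g)) (g : G) :
    Nat.card {k : G | IsConj (t g) k} = Nat.card {k : G | IsConj g k} := by
  classical
  have h1 := h.sum_comp ht (fun k => if IsConj (t g) k then 1 else 0) (by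
    intro k l
    have : IsConj k (l * k * l⁻¹) := isConj_iff.mpr ⟨l, rfl⟩
    have h2 : IsConj (t g) (l * k * l⁻¹) ↔ IsConj (t g) k :=
      ⟨fun h => h.trans this.symm, fun h => h.trans this⟩
    simp only [h2])
  simp only [isConj_lift_iff ht, Finset.sum_boole] at h1
  rw [Nat.card_eq_fintype_card, Nat.card_eq_fintype_card, Fintype.card_subtype,
    Fintype.card_subtype]
  exact_mod_cast h1.symm

end TableAutomorphisms

section Transpositions

variable {α : Type} [Fintype α] [DecidableEq α]

lemma IsIrrChar.mul_sum_swap {f : Perm α → ℂ} (hf : IsIrrChar (Perm α) f) (g : Perm α) :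
    f 1 * ∑ x, ∑ y, f (g * swap x y) = (∑ x, ∑ y, f (swap x y)) * f g := by
  obtain ⟨V, hV, rfl⟩ := hf
  obtain ⟨c, hc⟩ := V.exists_eq_smul_one_of_commute (∑ x : α, ∑ y : α, V.ρ (swap x y)) (by
    intro k
    have : (∑ x, ∑ y, V.ρ (swap x y)) * V.ρ k = V.ρ k * (∑ x, ∑ y, V.ρ (swap x y)) := by
      simp only [Finset.sum_mul, Finset.mul_sum]
      refine (Fintype.sum_equiv k _ _ fun x => Fintype.sum_equiv k _ _ fun y => ?_).symm
      rw [← map_mul, ← map_mul, Equiv.mul_swap_eq_swap_mul]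
    exact this)
  have h1 : ∀ k : Perm α, ∑ x, ∑ y, V.character (k * swap x y) = c * V.character k := by
    intro k
    have h2 : V.ρ k * (∑ x : α, ∑ y : α, V.ρ (swap x y)) = c • V.ρ k := by
      rw [hc]
      ext v
      simp
    have h3 := congrArg (LinearMap.trace ℂ V) h2
    simp only [Finset.mul_sum, ← map_mul, map_sum, map_smul, smul_eq_mul] at h3
    exact h3
  have h4 := h1 1
  simp only [one_mul] at h4
  rw [h1, h4]
  ring

variable {σ : Equiv.Perm {f : Perm α → ℂ // IsIrrChar (Perm α) f}}
  {τ : Equiv.Perm (ConjClasses (Perm α))} {t : Perm α → Perm α}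

lemma IsTableAut.sum_swap (h : IsTableAut (Perm α) σ τ)
    (ht : ∀ g, ConjClasses.mk (t g) = τ (ConjClasses.mk g)) (h1 : t 1 = 1)
    (hs : ∀ x y, x ≠ y → IsConj (t (swap x y)) (swap x y)) (φ : Perm α → ℂ)
    (hφ : ∀ g k, φ (k * g * k⁻¹) = φ g) (g : Perm α) :
    ∑ x, ∑ y, φ (t g * swap x y) = ∑ x, ∑ y, φ (t (g * swap x y)) := by
  have hmem := mem_span_isIrrChar φ hφ
  clear hφ
  induction hmem using Submodule.span_induction with
  | mem f hf =>
    have e1 := IsIrrChar.mul_sum_swap hf (t g)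
    have e2 := (h.isIrrChar_comp ht hf).mul_sum_swap g
    have e3 : ∑ x, ∑ y, (f ∘ t) (swap x y) = ∑ x, ∑ y, f (swap x y) := by
      refine Finset.sum_congr rfl fun x _ => Finset.sum_congr rfl fun y _ => ?_
      by_cases hxy : x = y
      · subst hxy
        simp only [swap_self, Function.comp_apply]
        exact congrArg f h1
      · exact (hs x y hxy).apply_eq_of_conj_invariant (IsIrrChar.conj hf)
    have e4 : (f ∘ t) 1 = f 1 := congrArg f h1
    rw [e3, e4] at e2
    obtain ⟨m, hm, hfm⟩ := IsIrrChar.exists_one_eq_natCast hf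
    have hne : f 1 ≠ 0 := by rw [hfm]; exact_mod_cast hm.ne'
    exact mul_left_cancel₀ hne (e1.trans e2.symm)
  | zero => simp
  | add f f' _ _ h1 h2 => simp [Finset.sum_add_distrib, h1, h2]
  | smul c f _ h1 => simp [← Finset.mul_sum, h1]

/-- Counting transposition neighbours by the value of an invariant class function yields
another invariant. -/
lemma IsTableAut.card_swap_filter (h : IsTableAut (Perm α) σ τ)
    (ht : ∀ g, ConjClasses.mk (t g) = τ (ConjClasses.mk g)) (h1 : t 1 = 1)
    (hs : ∀ x y, x ≠ y → IsConj (t (swap x y)) (swap x y)) {X : Type*} (F : Perm α → X)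
    (hF : ∀ g k, F (k * g * k⁻¹) = F g) (hFt : ∀ g, F (t g) = F g) (P : X → Prop)
    [DecidablePred P] (g : Perm α) :
    ∑ x, ∑ y, (if P (F (t g * swap x y)) then 1 else 0 : ℚ) =
      ∑ x, ∑ y, (if P (F (g * swap x y)) then 1 else 0 : ℚ) := by
  have := h.sum_swap ht h1 hs (fun k => if P (F k) then 1 else 0)
    (fun g k => by simp only [hF]) g
  simp only [hFt] at this
  exact_mod_cast this

end Transpositions

section CycleSums

open Function

variable {α : Type}

namespace Equiv.Perm

lemma pow_minimalPeriod_apply (c : Perm α) (x : α) : (c ^ minimalPeriod c x) x = x := by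
  rw [← iterate_eq_pow]
  exact iterate_minimalPeriod

lemma pow_apply_eq_pow_apply {c : Perm α} {x : α} {i j : ℕ} (hi : i < minimalPeriod c x)
    (hj : j < minimalPeriod c x) : (c ^ i) x = (c ^ j) x ↔ i = j := by
  rw [← iterate_eq_pow, ← iterate_eq_pow]
  exact iterate_eq_iterate_iff_of_lt_minimalPeriod hi hj

lemma pow_apply_eq_self {c : Perm α} {x : α} {i : ℕ} (hi : i < minimalPeriod c x) :
    (c ^ i) x = x ↔ i = 0 :=
  pow_apply_eq_pow_apply (j := 0) hi (by omega)

lemma mul_swap_pow_apply [DecidableEq α] {c : Perm α} {x y : α} {i : ℕ}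
    (hne : ∀ j, 0 < j → j < i → (c ^ j) x ≠ x ∧ (c ^ j) x ≠ y) (j : ℕ) (hj : 0 < j)
    (hji : j ≤ i) : ((c * swap x y) ^ j) y = (c ^ j) x := by
  induction j, hj using Nat.le_induction with
  | base => simp
  | succ j hj ih =>
    have h1 := hne j hj (by omega)
    rw [pow_succ', mul_apply, ih (by omega), mul_apply, swap_apply_of_ne_of_ne h1.1 h1.2,
      pow_succ', mul_apply]

lemma injOn_pow_apply (c : Perm α) (x : α) :
    Set.InjOn (fun j => (c ^ j) x) (Finset.Ioc 0 (minimalPeriod c x) : Set ℕ) := by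
  intro a ha b hb hab
  simp only [Finset.coe_Ioc, Set.mem_Ioc] at ha hb
  dsimp only at hab
  rcases ha.2.lt_or_eq with ha' | ha' <;> rcases hb.2.lt_or_eq with hb' | hb'
  · exact (pow_apply_eq_pow_apply ha' hb').mp hab
  · rw [hb', pow_minimalPeriod_apply, pow_apply_eq_self ha'] at hab
    omega
  · rw [ha', pow_minimalPeriod_apply, eq_comm, pow_apply_eq_self hb'] at hab
    omega
  · omega

lemma minimalPeriod_pos [Finite α] (c : Perm α) (x : α) : 0 < minimalPeriod c x :=
  minimalPeriod_pos_of_mem_periodicPts (c.injective.mem_periodicPts x)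

variable [Fintype α]

/-- The sum over all points of a function of the length of the cycle through the point. -/
noncomputable def cycleSum (ψ : ℕ → ℚ) (c : Perm α) : ℚ := ∑ x, ψ (minimalPeriod c x)

lemma cycleSum_conj (ψ : ℕ → ℚ) (c k : Perm α) : cycleSum ψ (k * c * k⁻¹) = cycleSum ψ c := by
  refine (Fintype.sum_equiv k _ _ fun x => ?_).symm
  congr 1
  rw [minimalPeriod_eq_minimalPeriod_iff]
  intro m
  rw [IsPeriodicPt, IsPeriodicPt, IsFixedPt, IsFixedPt, iterate_eq_pow, iterate_eq_pow, conj_pow]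
  simp

variable [DecidableEq α]

lemma minimalPeriod_mul_swap {c : Perm α} {x y : α} {i : ℕ} (hi : 0 < i)
    (hy : (c ^ i) x = y) (hne : ∀ j, 0 < j → j < i → (c ^ j) x ≠ x ∧ (c ^ j) x ≠ y)
    (j : ℕ) (hj : 0 < j) (hji : j ≤ i) : minimalPeriod (c * swap x y) ((c ^ j) x) = i := by
  have hper : minimalPeriod (c * swap x y) y = i := by
    have h1 : IsPeriodicPt (c * swap x y) i y := by
      rw [IsPeriodicPt, IsFixedPt, iterate_eq_pow, mul_swap_pow_apply hne i hi le_rfl, hy]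
    refine le_antisymm (h1.minimalPeriod_le hi) ?_
    by_contra! hlt
    have h2 := pow_minimalPeriod_apply (c * swap x y) y
    have h3 := minimalPeriod_pos (c * swap x y) y
    rw [mul_swap_pow_apply hne _ h3 hlt.le] at h2
    exact (hne _ h3 hlt).2 h2
  rw [← mul_swap_pow_apply hne j hj hji, ← iterate_eq_pow,
    minimalPeriod_apply_iterate ((c * swap x y).injective.mem_periodicPts y), hper]

lemma cycleSum_mul_swap (ψ : ℕ → ℚ) (c : Perm α) (x : α) {i l : ℕ} (hl : minimalPeriod c x = l)
    (hi : 0 < i) (hil : i < l) :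
    cycleSum ψ (c * swap x ((c ^ i) x)) + l * ψ l =
      cycleSum ψ c + i * ψ i + (l - i) * ψ (l - i) := by
  subst hl
  set l := minimalPeriod c x with hl
  set y := (c ^ i) x with hy
  set O : Finset α := (Finset.Ioc 0 l).image fun j => (c ^ j) x with hO
  have hxl : (c ^ l) x = x := pow_minimalPeriod_apply c x
  have hyx : ∀ j, (c ^ j) y = (c ^ (j + i)) x := by
    intro j
    rw [pow_add, mul_apply]
  have hyl : (c ^ (l - i)) y = x := by
    rw [hyx, Nat.sub_add_cancel hil.le, hxl]
  have hA : ∀ j ∈ Finset.Ioc 0 i, minimalPeriod (c * swap x y) ((c ^ j) x) = i := by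
    intro j hj
    rw [Finset.mem_Ioc] at hj
    refine minimalPeriod_mul_swap hi rfl (fun j hj hji => ?_) j hj.1 hj.2
    rw [Ne, pow_apply_eq_self (by omega), Ne,
      pow_apply_eq_pow_apply (hji.trans hil) hil]
    omega
  have hB : ∀ j ∈ Finset.Ioc i l, minimalPeriod (c * swap x y) ((c ^ j) x) = l - i := by
    intro j hj
    rw [Finset.mem_Ioc] at hj
    have := minimalPeriod_mul_swap (c := c) (x := y) (y := x) (i := l - i) (by omega) hyl
      (fun j hj hji => ?_) (j - i) (by omega) (by omega)
    · rwa [hyx, Nat.sub_add_cancel hj.1.le, swap_comm] at this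
    · rw [hyx, Ne, Ne, pow_apply_eq_self (by omega), hy, pow_apply_eq_pow_apply (by omega) hil]
      omega
  have hcO : ∀ z, c z ∈ O → z ∈ O := by
    intro z hz
    obtain ⟨j, hj, hjz⟩ := Finset.mem_image.mp hz
    rw [Finset.mem_Ioc] at hj
    have hz' : (c ^ (j - 1)) x = z := by
      apply c.injective
      rw [← hjz, ← mul_apply, ← pow_succ', Nat.sub_add_cancel hj.1]
    rcases Nat.eq_zero_or_pos (j - 1) with h0 | h0
    · rw [h0, pow_zero, one_apply] at hz'
      exact Finset.mem_image.mpr ⟨l, by simp; omega, by rw [hxl, hz']⟩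
    · exact Finset.mem_image.mpr ⟨j - 1, by simp; omega, hz'⟩
  have hxO : x ∈ O := Finset.mem_image.mpr ⟨l, by simp; omega, hxl⟩
  have hyO : y ∈ O := Finset.mem_image.mpr ⟨i, by simp; omega, rfl⟩
  have hout : ∀ z ∉ O, minimalPeriod (c * swap x y) z = minimalPeriod c z := by
    intro z hz
    have h1 : ∀ m, ((c * swap x y) ^ m) z = (c ^ m) z ∧ (c ^ m) z ∉ O := by
      intro m
      induction m with
      | zero => simpa using hz
      | succ m ih =>
        have hnx : (c ^ m) z ≠ x := fun h => ih.2 (h ▸ hxO)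
        have hny : (c ^ m) z ≠ y := fun h => ih.2 (h ▸ hyO)
        refine ⟨?_, fun h => ih.2 (hcO _ ?_)⟩
        · rw [pow_succ', mul_apply, ih.1, mul_apply, swap_apply_of_ne_of_ne hnx hny, pow_succ',
            mul_apply]
        · rwa [pow_succ', mul_apply] at h
    rw [minimalPeriod_eq_minimalPeriod_iff]
    intro m
    rw [IsPeriodicPt, IsPeriodicPt, IsFixedPt, IsFixedPt, iterate_eq_pow, iterate_eq_pow, (h1 m).1]
  have hin : ∀ z ∈ O, minimalPeriod c z = l := by
    intro z hz
    obtain ⟨j, hj, rfl⟩ := Finset.mem_image.mp hz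
    rw [← iterate_eq_pow, minimalPeriod_apply_iterate (c.injective.mem_periodicPts x)]
  have hsplit : ∀ f : α → ℚ, ∑ z, f z = ∑ z ∈ O, f z + ∑ z ∈ Oᶜ, f z := fun f =>
    (Finset.sum_add_sum_compl O f).symm
  rw [cycleSum, cycleSum, hsplit, hsplit fun z => ψ (minimalPeriod c z)]
  have e1 : ∑ z ∈ Oᶜ, ψ (minimalPeriod (c * swap x y) z) = ∑ z ∈ Oᶜ, ψ (minimalPeriod c z) :=
    Finset.sum_congr rfl fun z hz => by rw [hout z (Finset.mem_compl.mp hz)]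
  have e2 : ∑ z ∈ O, ψ (minimalPeriod c z) = l * ψ l := by
    rw [Finset.sum_congr rfl fun z hz => by rw [hin z hz], Finset.sum_const, hO,
      Finset.card_image_of_injOn (injOn_pow_apply c x), Nat.card_Ioc, nsmul_eq_mul, Nat.sub_zero]
  have e3 : ∑ z ∈ O, ψ (minimalPeriod (c * swap x y) z) = i * ψ i + (l - i) * ψ (l - i) := by
    rw [hO, Finset.sum_image (injOn_pow_apply c x),
      ← Finset.sum_Ioc_consecutive _ (Nat.zero_le i) hil.le,
      Finset.sum_congr (g := fun _ => ψ i) (s₁ := Finset.Ioc 0 i) rfl fun j hj => by rw [hA j hj],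
      Finset.sum_congr (g := fun _ => ψ (l - i)) (s₁ := Finset.Ioc i l) rfl
        fun j hj => by rw [hB j hj]]
    simp [Nat.cast_sub hil.le]
  rw [e1, e2, e3]
  ring

/-- The number of cycles, fixed points included. -/
noncomputable abbrev cycleCount (c : Perm α) : ℚ := cycleSum (fun l => 1 / l) c

/-- The sum of the squares of the cycle lengths. -/
noncomputable abbrev cycleSq (c : Perm α) : ℚ := cycleSum (fun l => l) c

lemma cycleCount_mul_swap (c : Perm α) (x : α) {i : ℕ} (hi : 0 < i)
    (hil : i < minimalPeriod c x) :
    cycleCount (c * swap x ((c ^ i) x)) = cycleCount c + 1 := by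
  have h := cycleSum_mul_swap (fun l => 1 / l) c x rfl hi hil
  have h1 : (i : ℚ) ≠ 0 := by exact_mod_cast hi.ne'
  have h2 : (minimalPeriod c x : ℚ) ≠ 0 := by exact_mod_cast (hi.trans hil).ne'
  have h3 : (minimalPeriod c x : ℚ) - i ≠ 0 := by
    rw [sub_ne_zero]; exact_mod_cast hil.ne'
  rw [Nat.cast_sub hil.le] at h
  rw [mul_one_div_cancel h1, mul_one_div_cancel h2, mul_one_div_cancel h3] at h
  linarith

lemma cycleSq_mul_swap (c : Perm α) (x : α) {i : ℕ} (hi : 0 < i)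
    (hil : i < minimalPeriod c x) :
    cycleSq (c * swap x ((c ^ i) x)) + 2 * (i * (minimalPeriod c x - i) : ℕ) = cycleSq c := by
  have h := cycleSum_mul_swap (fun l => l) c x rfl hi hil
  push_cast [Nat.cast_sub hil.le] at h ⊢
  linarith

/-- Multiplication by a transposition either merges two cycles or splits one. -/
lemma mul_swap_merges {c : Perm α} {x y : α} (hxy : x ≠ y)
    (h : ∀ i, 0 < i → i < minimalPeriod c x → (c ^ i) x ≠ y) :
    cycleCount (c * swap x y) = cycleCount c - 1 ∧ cycleSq c < cycleSq (c * swap x y) := by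
  set l := minimalPeriod c x with hl
  set c' := c * swap x y with hc'
  have hl0 : 0 < l := minimalPeriod_pos c x
  have h1 : (c' ^ l) y = x := by
    rw [hc', mul_swap_pow_apply (i := l) _ l hl0 le_rfl, pow_minimalPeriod_apply]
    intro j hj hjl
    refine ⟨?_, h j hj hjl⟩
    rw [Ne, pow_apply_eq_self hjl]
    omega
  set j := l % minimalPeriod c' y with hj
  have hper : 0 < minimalPeriod c' y := minimalPeriod_pos c' y
  have hjlt : j < minimalPeriod c' y := Nat.mod_lt _ hper
  have hjx : (c' ^ j) y = x := by
    rw [← iterate_eq_pow, hj, iterate_mod_minimalPeriod_eq, iterate_eq_pow, h1]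
  have hj0 : 0 < j := by
    rw [Nat.pos_iff_ne_zero]
    intro h0
    rw [h0, pow_zero, one_apply] at hjx
    exact hxy hjx.symm
  have hcc : c' * swap y ((c' ^ j) y) = c := by
    rw [hjx, hc', swap_comm y x, mul_assoc, swap_mul_self, mul_one]
  have e1 := cycleCount_mul_swap c' y hj0 hjlt
  have e2 := cycleSq_mul_swap c' y hj0 hjlt
  rw [hcc] at e1 e2
  refine ⟨by linarith, ?_⟩
  have : 0 < j * (minimalPeriod c' y - j) := Nat.mul_pos hj0 (by omega)
  have : (0 : ℚ) < (j * (minimalPeriod c' y - j) : ℕ) := by exact_mod_cast this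
  linarith

lemma sum_eq_sum_Ioo_of_forall {c : Perm α} {x : α} (f : α → ℚ) (hx : f x = 0)
    (hf : ∀ y, x ≠ y → (∀ i, 0 < i → i < minimalPeriod c x → (c ^ i) x ≠ y) → f y = 0) :
    ∑ y, f y = ∑ i ∈ Finset.Ioo 0 (minimalPeriod c x), f ((c ^ i) x) := by
  rw [← Finset.sum_image (f := f) (g := fun i => (c ^ i) x)
    ((injOn_pow_apply c x).mono fun i hi => by simp at hi ⊢; omega)]
  refine (Finset.sum_subset (Finset.subset_univ _) fun y _ hy => ?_).symm
  by_cases hxy : x = y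
  · rw [← hxy, hx]
  · refine hf y hxy fun i hi hil h => hy ?_
    exact Finset.mem_image.mpr ⟨i, Finset.mem_Ioo.mpr ⟨hi, hil⟩, h⟩

lemma sum_cycleCount_mul_swap (c : Perm α) :
    ∑ x, ∑ y, (if cycleCount (c * swap x y) = cycleCount c + 1 then 1 else 0 : ℚ) =
      cycleSq c - Fintype.card α := by
  have : ∀ x, ∑ y, (if cycleCount (c * swap x y) = cycleCount c + 1 then 1 else 0 : ℚ) =
      minimalPeriod c x - 1 := by
    intro x
    rw [sum_eq_sum_Ioo_of_forall (c := c) (x := x)]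
    · rw [Finset.sum_congr rfl fun i hi => if_pos (cycleCount_mul_swap c x
        (Finset.mem_Ioo.mp hi).1 (Finset.mem_Ioo.mp hi).2)]
      have := minimalPeriod_pos c x
      simp [Nat.cast_sub (Nat.succ_le_of_lt this)]
    · rw [swap_self, if_neg]
      have : c * Equiv.refl α = c := rfl
      rw [this]
      linarith
    · intro y hxy h
      rw [(mul_swap_merges hxy h).1, if_neg]
      linarith
  rw [Finset.sum_congr rfl fun x _ => this x, Finset.sum_sub_distrib]
  simp [cycleSum]

lemma sum_cycleSq_mul_swap (c : Perm α) {v : ℕ} (hv : 0 < v) :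
    ∑ x, ∑ y, (if cycleSq (c * swap x y) + 2 * v = cycleSq c then 1 else 0 : ℚ) =
      cycleSum (fun l => ((Finset.Ioo 0 l).filter fun i => i * (l - i) = v).card) c := by
  have hv' : (0 : ℚ) < v := by exact_mod_cast hv
  refine Finset.sum_congr rfl fun x _ => ?_
  dsimp only
  rw [sum_eq_sum_Ioo_of_forall (c := c) (x := x), Finset.card_filter]
  · push_cast
    refine Finset.sum_congr rfl fun i hi => ?_
    have := cycleSq_mul_swap c x (Finset.mem_Ioo.mp hi).1 (Finset.mem_Ioo.mp hi).2
    have h2 : cycleSq (c * swap x ((c ^ i) x)) + 2 * v = cycleSq c ↔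
        i * (minimalPeriod c x - i) = v := by
      rw [← this, add_right_inj, mul_right_inj' two_ne_zero, Nat.cast_inj, eq_comm]
    exact if_congr h2 rfl rfl
  · rw [swap_self, if_neg]
    have : c * Equiv.refl α = c := rfl
    rw [this]
    linarith
  · intro y hxy h
    have := (mul_swap_merges hxy h).2
    rw [if_neg]
    linarith

end Equiv.Perm

end CycleSums

section Invariance

open Function Equiv.Perm

lemma Equiv.Perm.orderOf_dvd_iff_minimalPeriod {α : Type} (c : Perm α) (k : ℕ) :
    orderOf c ∣ k ↔ ∀ x, minimalPeriod c x ∣ k := by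
  rw [orderOf_dvd_iff_pow_eq_one, Equiv.ext_iff]
  refine forall_congr' fun x => ?_
  rw [← isPeriodicPt_iff_minimalPeriod_dvd, IsPeriodicPt, IsFixedPt, iterate_eq_pow, one_apply]

variable {α : Type} [Fintype α]

namespace Equiv.Perm

lemma card_le_cycleCount_iff (c : Perm α) : (Fintype.card α : ℚ) ≤ cycleCount c ↔ c = 1 := by
  constructor
  · intro h
    have hle : ∀ x ∈ Finset.univ, (1 / (minimalPeriod c x : ℚ)) ≤ 1 := by
      intro x _
      have : (1 : ℚ) ≤ minimalPeriod c x := by exact_mod_cast minimalPeriod_pos c x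
      exact (div_le_one (by linarith)).mpr this
    have hsum : ∑ x, (1 / (minimalPeriod c x : ℚ)) = ∑ _x : α, (1 : ℚ) := by
      refine le_antisymm (Finset.sum_le_sum hle) ?_
      simpa [cycleCount, cycleSum] using h
    ext x
    have h1 := (Finset.sum_eq_sum_iff_of_le hle).mp hsum x (Finset.mem_univ x)
    have h2 : minimalPeriod c x = 1 := by
      have h3 : (minimalPeriod c x : ℚ) = 1 := by
        rwa [one_div, inv_eq_one] at h1
      exact_mod_cast h3
    simpa [h2] using pow_minimalPeriod_apply c x
  · rintro rfl
    simp [cycleSum]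

lemma cycleCount_nonneg (c : Perm α) : 0 ≤ cycleCount c :=
  Finset.sum_nonneg fun _ _ => by positivity

/-- The number of points lying on cycles of length `l`. -/
noncomputable abbrev pointsOnCycles (l : ℕ) (c : Perm α) : ℚ :=
  cycleSum (fun m => if m = l then 1 else 0) c

lemma pointsOnCycles_eq_zero_iff (c : Perm α) (l : ℕ) :
    pointsOnCycles l c = 0 ↔ ∀ x, minimalPeriod c x ≠ l := by
  rw [pointsOnCycles, cycleSum, Finset.sum_boole]
  simp [Finset.filter_eq_empty_iff]

lemma cycleSum_eq_sum_pointsOnCycles (ψ : ℕ → ℚ) (n : ℕ) (hψ : ∀ l, n ≤ l → ψ l = 0)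
    (c : Perm α) : cycleSum ψ c = ∑ l ∈ Finset.range n, ψ l * pointsOnCycles l c := by
  simp only [pointsOnCycles, cycleSum, Finset.mul_sum]
  rw [Finset.sum_comm]
  refine Finset.sum_congr rfl fun x _ => ?_
  by_cases hx : minimalPeriod c x < n
  · rw [Finset.sum_eq_single (minimalPeriod c x)] <;> simp_all [eq_comm]
  · rw [hψ _ (by omega)]
    refine (Finset.sum_eq_zero fun l hl => ?_).symm
    rw [Finset.mem_range] at hl
    rw [if_neg (by omega), mul_zero]

lemma orderOf_eq_of_pointsOnCycles {c d : Perm α}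
    (h : ∀ l, 2 ≤ l → pointsOnCycles l c = pointsOnCycles l d) : orderOf c = orderOf d := by
  have key : ∀ {c d : Perm α}, (∀ l, 2 ≤ l → pointsOnCycles l c = pointsOnCycles l d) →
      orderOf c ∣ orderOf d := by
    intro c d h
    rw [orderOf_dvd_iff_minimalPeriod]
    intro x
    rcases Nat.lt_or_ge (minimalPeriod c x) 2 with h2 | h2
    · have := minimalPeriod_pos c x
      rw [show minimalPeriod c x = 1 by omega]
      exact one_dvd _
    · have h3 : pointsOnCycles (minimalPeriod c x) d ≠ 0 := by
        rw [← h _ h2, Ne, pointsOnCycles_eq_zero_iff]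
        exact fun h => h x rfl
      rw [Ne, pointsOnCycles_eq_zero_iff] at h3
      push Not at h3
      obtain ⟨y, hy⟩ := h3
      rw [← hy]
      exact (orderOf_dvd_iff_minimalPeriod d _).mp dvd_rfl y
  exact Nat.dvd_antisymm (key h) (key fun l hl => (h l hl).symm)

variable [DecidableEq α]

lemma exists_cycleCount_mul_swap {c : Perm α} (hc : c ≠ 1) :
    ∃ x y, cycleCount (c * swap x y) = cycleCount c + 1 := by
  obtain ⟨x, hx⟩ : ∃ x, c x ≠ x := by
    by_contra! h
    exact hc (Equiv.ext h)
  have h0 := minimalPeriod_pos c x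
  have h1 : minimalPeriod c x ≠ 1 := by
    rwa [Ne, minimalPeriod_eq_one_iff_isFixedPt]
  exact ⟨x, (c ^ 1) x, cycleCount_mul_swap c x one_pos (by omega)⟩

lemma cycleCount_mul_swap_mem (c : Perm α) (x y : α) :
    ∃ e : ℤ, e ≤ 1 ∧ cycleCount (c * swap x y) = cycleCount c + e := by
  by_cases hxy : x = y
  · refine ⟨0, by norm_num, ?_⟩
    subst hxy
    rw [swap_self]
    have : c * Equiv.refl α = c := rfl
    rw [this]
    simp
  · by_cases h : ∀ i, 0 < i → i < minimalPeriod c x → (c ^ i) x ≠ y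
    · exact ⟨-1, by norm_num, by rw [(mul_swap_merges hxy h).1]; push_cast; ring⟩
    · push Not at h
      obtain ⟨i, hi, hil, rfl⟩ := h
      exact ⟨1, le_rfl, by rw [cycleCount_mul_swap c x hi hil]; simp⟩

lemma le_cycleCount_iff_exists_swap [Nonempty α] (c : Perm α) (k : ℕ) :
    (Fintype.card α : ℚ) - (k + 1 : ℕ) ≤ cycleCount c ↔
      ∃ x y, (Fintype.card α : ℚ) - k ≤ cycleCount (c * swap x y) := by
  push_cast
  constructor
  · intro h
    by_cases hc : c = 1
    · obtain ⟨x⟩ := ‹Nonempty α›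
      refine ⟨x, x, ?_⟩
      have h1 : c * swap x x = 1 := by rw [hc, swap_self]; rfl
      have h2 := (card_le_cycleCount_iff (c * swap x x)).mpr h1
      linarith [(Nat.cast_nonneg k : (0 : ℚ) ≤ k)]
    · obtain ⟨x, y, hxy⟩ := exists_cycleCount_mul_swap hc
      exact ⟨x, y, by linarith⟩
  · rintro ⟨x, y, h⟩
    obtain ⟨e, he, hxy⟩ := cycleCount_mul_swap_mem c x y
    have : (e : ℚ) ≤ 1 := by exact_mod_cast he
    linarith

lemma exists_cycleCount_eq_intCast (c : Perm α) : ∃ z : ℤ, cycleCount c = z := by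
  have key : ∀ (k : ℕ) (c : Perm α), (Fintype.card α : ℚ) - k ≤ cycleCount c →
      ∃ z : ℤ, cycleCount c = z := by
    intro k
    induction k with
    | zero =>
      intro c hc
      rw [Nat.cast_zero, sub_zero, card_le_cycleCount_iff] at hc
      exact ⟨Fintype.card α, by rw [hc]; simp [cycleSum]⟩
    | succ k ih =>
      intro c hc
      by_cases h1 : c = 1
      · exact ⟨Fintype.card α, by rw [h1]; simp [cycleSum]⟩
      · obtain ⟨x, y, hxy⟩ := exists_cycleCount_mul_swap h1
        push_cast at hc
        obtain ⟨z, hz⟩ := ih (c * swap x y) (by linarith)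
        exact ⟨z - 1, by push_cast; linarith⟩
  exact key (Fintype.card α) c (by simpa using cycleCount_nonneg c)

end Equiv.Perm

variable [DecidableEq α] [Nonempty α] {σ : Equiv.Perm {f : Perm α → ℂ // IsIrrChar (Perm α) f}}
  {τ : Equiv.Perm (ConjClasses (Perm α))} {t : Perm α → Perm α}

lemma IsTableAut.cycleCount_eq (h : IsTableAut (Perm α) σ τ)
    (ht : ∀ g, ConjClasses.mk (t g) = τ (ConjClasses.mk g)) (h1 : t 1 = 1)
    (hs : ∀ x y, x ≠ y → IsConj (t (swap x y)) (swap x y)) (g : Perm α) :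
    cycleCount (t g) = cycleCount g := by
  have key : ∀ (k : ℕ) (g : Perm α), (Fintype.card α : ℚ) - k ≤ cycleCount (t g) ↔
      (Fintype.card α : ℚ) - k ≤ cycleCount g := by
    intro k
    induction k with
    | zero =>
      intro g
      have h2 := isConj_lift_iff ht (a := 1) (b := g)
      rw [h1, isConj_one_right, isConj_one_right] at h2
      rw [Nat.cast_zero, sub_zero, card_le_cycleCount_iff, card_le_cycleCount_iff, h2]
    | succ k ih =>
      intro g
      have h2 := h.card_swap_filter ht h1 hs
        (fun c => decide ((Fintype.card α : ℚ) - k ≤ cycleCount c))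
        (fun c l => by rw [cycleCount, cycleSum_conj]) (fun c => decide_eq_decide.mpr (ih c))
        (fun p => p = true) g
      simp only [decide_eq_true_eq] at h2
      have h3 : ∀ c : Perm α, (0 < ∑ x, ∑ y,
          (if (Fintype.card α : ℚ) - k ≤ cycleCount (c * Equiv.swap x y) then 1 else 0 : ℚ)) ↔
            (Fintype.card α : ℚ) - (k + 1 : ℕ) ≤ cycleCount c := by
        intro c
        rw [le_cycleCount_iff_exists_swap, Finset.sum_pos_iff_of_nonneg
          (fun _ _ => Finset.sum_nonneg fun _ _ => by positivity)]
        refine exists_congr fun x => ?_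
        rw [Finset.sum_pos_iff_of_nonneg (fun _ _ => by positivity)]
        simp only [Finset.mem_univ, true_and]
        refine exists_congr fun y => ?_
        split_ifs with hp <;> simp [hp]
      rw [← h3, ← h3, h2]
  obtain ⟨a, ha⟩ := exists_cycleCount_eq_intCast g
  obtain ⟨b, hb⟩ := exists_cycleCount_eq_intCast (t g)
  have hle : ∀ c : Perm α, cycleCount c ≤ Fintype.card α := by
    intro c
    by_cases hc : c = 1
    · rw [hc]; simp [cycleSum]
    · rw [← card_le_cycleCount_iff] at hc
      exact (not_le.mp hc).le
  have hag := hle g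
  have hbg := hle (t g)
  have ka := key (Fintype.card α - a).toNat g
  have kb := key (Fintype.card α - b).toNat g
  rw [ha] at hag ka kb ⊢
  rw [hb] at hbg ka kb ⊢
  norm_cast at hag hbg ⊢
  have hcast : ∀ z : ℤ, z ≤ Fintype.card α →
      (Fintype.card α : ℚ) - ((Fintype.card α - z).toNat : ℕ) = z := by
    intro z hz
    rw [← Int.cast_natCast (Int.toNat _), Int.toNat_of_nonneg (by omega)]
    push_cast
    ring
  rw [hcast _ hag] at ka
  rw [hcast _ hbg] at kb
  exact le_antisymm (by exact_mod_cast kb.mp le_rfl) (by exact_mod_cast ka.mpr le_rfl)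

lemma IsTableAut.cycleSq_eq (h : IsTableAut (Perm α) σ τ)
    (ht : ∀ g, ConjClasses.mk (t g) = τ (ConjClasses.mk g)) (h1 : t 1 = 1)
    (hs : ∀ x y, x ≠ y → IsConj (t (swap x y)) (swap x y)) (g : Perm α) :
    cycleSq (t g) = cycleSq g := by
  have h2 := h.card_swap_filter ht h1 hs cycleCount (fun c l => cycleSum_conj _ c l)
    (h.cycleCount_eq ht h1 hs) (fun p => p = cycleCount g + 1) g
  have h3 := sum_cycleCount_mul_swap (t g)
  rw [h.cycleCount_eq ht h1 hs, h2, sum_cycleCount_mul_swap] at h3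
  linarith

lemma IsTableAut.pointsOnCycles_eq (h : IsTableAut (Perm α) σ τ)
    (ht : ∀ g, ConjClasses.mk (t g) = τ (ConjClasses.mk g)) (h1 : t 1 = 1)
    (hs : ∀ x y, x ≠ y → IsConj (t (swap x y)) (swap x y)) (g : Perm α) (l : ℕ) (hl : 2 ≤ l) :
    pointsOnCycles l (t g) = pointsOnCycles l g := by
  induction l using Nat.strong_induction_on with
  | _ l ih =>
    set ψ : ℕ → ℚ := fun m => ((Finset.Ioo 0 m).filter fun i => i * (m - i) = l - 1).card with hψ
    have h2 : cycleSum ψ (t g) = cycleSum ψ g := by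
      rw [← sum_cycleSq_mul_swap (t g) (v := l - 1) (by omega),
        ← sum_cycleSq_mul_swap g (v := l - 1) (by omega), h.cycleSq_eq ht h1 hs]
      exact h.card_swap_filter ht h1 hs cycleSq (fun c l => cycleSum_conj _ c l)
        (h.cycleSq_eq ht h1 hs) (fun p => p + 2 * ((l - 1 : ℕ) : ℚ) = cycleSq g) g
    have hsupp : ∀ m, l + 1 ≤ m → ψ m = 0 := by
      intro m hm
      simp only [hψ, Nat.cast_eq_zero, Finset.card_eq_zero, Finset.filter_eq_empty_iff,
        Finset.mem_Ioo]
      intro i hi heq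
      obtain ⟨j, rfl⟩ : ∃ j, m = i + j + 2 - 1 := ⟨m - i - 1, by omega⟩
      obtain ⟨i, rfl⟩ : ∃ i', i = i' + 1 := ⟨i - 1, by omega⟩
      rw [show i + 1 + j + 2 - 1 - (i + 1) = j + 1 by omega] at heq
      have : (i + 1) * (j + 1) ≤ i + j := by omega
      nlinarith [Nat.zero_le (i * j)]
    have hψl : ψ l ≠ 0 := by
      simp only [hψ, Ne, Nat.cast_eq_zero, Finset.card_eq_zero]
      refine Finset.Nonempty.ne_empty ⟨1, ?_⟩
      simp only [Finset.mem_filter, Finset.mem_Ioo]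
      omega
    rw [cycleSum_eq_sum_pointsOnCycles ψ _ hsupp, cycleSum_eq_sum_pointsOnCycles ψ _ hsupp,
      Finset.sum_range_succ, Finset.sum_range_succ] at h2
    have h3 : ∑ m ∈ Finset.range l, ψ m * pointsOnCycles m (t g) =
        ∑ m ∈ Finset.range l, ψ m * pointsOnCycles m g := by
      refine Finset.sum_congr rfl fun m hm => ?_
      rw [Finset.mem_range] at hm
      rcases Nat.lt_or_ge m 2 with hm2 | hm2
      · have : ψ m = 0 := by
          simp only [hψ, Nat.cast_eq_zero, Finset.card_eq_zero, Finset.filter_eq_empty_iff,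
            Finset.mem_Ioo]
          omega
        rw [this, zero_mul, zero_mul]
      · rw [ih m hm hm2]
    rw [h3] at h2
    exact mul_left_cancel₀ hψl (add_left_cancel h2)

lemma IsTableAut.orderOf_eq (h : IsTableAut (Perm α) σ τ)
    (ht : ∀ g, ConjClasses.mk (t g) = τ (ConjClasses.mk g)) (h1 : t 1 = 1)
    (hs : ∀ x y, x ≠ y → IsConj (t (swap x y)) (swap x y)) (g : Perm α) :
    orderOf (t g) = orderOf g :=
  orderOf_eq_of_pointsOnCycles fun l hl => h.pointsOnCycles_eq ht h1 hs g l hl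

end Invariance

section ClassSizes

open Multiset Nat

/-- The order of the centralizer of a permutation with nontrivial cycle lengths `M`
on exactly `M.sum` points. -/
def Multiset.cycleWeight (M : Multiset ℕ) : ℕ := M.prod * ∏ n ∈ M.toFinset, (M.count n)!

lemma Multiset.cycleWeight_cons (a : ℕ) (M : Multiset ℕ) :
    (a ::ₘ M).cycleWeight = M.cycleWeight * (a * (M.count a + 1)) := by
  have h1 : ∀ M : Multiset ℕ, ∀ a, a ∈ M.toFinset ∨ M.count a = 0 := by
    intro M a
    rw [mem_toFinset, count_eq_zero]
    exact em _
  have h2 : ∏ n ∈ M.toFinset, (M.count n)! = ∏ n ∈ insert a M.toFinset, (M.count n)! := by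
    refine Finset.prod_subset (Finset.subset_insert _ _) fun n _ hn => ?_
    rw [(h1 M n).resolve_left hn, factorial_zero]
  rw [cycleWeight, cycleWeight, prod_cons, toFinset_cons, h2,
    ← Finset.mul_prod_erase _ _ (Finset.mem_insert_self a _),
    ← Finset.mul_prod_erase _ (fun n => (M.count n)!) (Finset.mem_insert_self a _), count_cons_self,
    factorial_succ, Finset.prod_congr rfl fun n hn => by
      rw [count_cons_of_ne (Finset.ne_of_mem_erase hn)]]
  ring

lemma Multiset.mul_count_le_sum (a : ℕ) (M : Multiset ℕ) : a * M.count a ≤ M.sum := by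
  induction M using Multiset.induction with
  | empty => simp
  | cons b M ih =>
    rw [count_cons, sum_cons]
    split_ifs with h
    · subst h; linarith
    · rw [Nat.add_zero]
      omega

lemma Multiset.cycleWeight_cons_le (a : ℕ) (M : Multiset ℕ) :
    (a ::ₘ M).cycleWeight ≤ M.cycleWeight * (a ::ₘ M).sum := by
  rw [cycleWeight_cons, sum_cons]
  have := mul_count_le_sum a M
  exact Nat.mul_le_mul_left _ (by linarith)

/-- The multisets of integers at least `2` with sum at most `6`. -/
def smallCycleTypes : List (Multiset ℕ) :=
  [0, {2}, {3}, {4}, {2, 2}, {5}, {3, 2}, {6}, {4, 2}, {3, 3}, {2, 2, 2}]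

lemma mem_smallCycleTypes {M : Multiset ℕ} (h2 : ∀ a ∈ M, 2 ≤ a) (hM : M.sum ≤ 6) :
    M ∈ smallCycleTypes := by
  rcases M.empty_or_exists_mem with rfl | ⟨a, ha⟩
  · decide
  obtain ⟨M, rfl⟩ := exists_cons_of_mem ha
  rw [forall_mem_cons] at h2
  rw [sum_cons] at hM
  obtain ⟨ha2, h2⟩ := h2
  clear ha
  rcases M.empty_or_exists_mem with rfl | ⟨b, hb⟩
  · rw [sum_zero] at hM
    have : a ≤ 6 := by omega
    interval_cases a <;> decide
  obtain ⟨M, rfl⟩ := exists_cons_of_mem hb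
  rw [forall_mem_cons] at h2
  rw [sum_cons] at hM
  obtain ⟨hb2, h2⟩ := h2
  clear hb
  rcases M.empty_or_exists_mem with rfl | ⟨c, hc⟩
  · rw [sum_zero] at hM
    have : a ≤ 4 := by omega
    have : b ≤ 4 := by omega
    interval_cases a <;> interval_cases b <;> first | omega | decide
  obtain ⟨M, rfl⟩ := exists_cons_of_mem hc
  rw [forall_mem_cons] at h2
  rw [sum_cons] at hM
  obtain ⟨hc2, h2⟩ := h2
  rcases M.empty_or_exists_mem with rfl | ⟨d, hd⟩
  · rw [sum_zero] at hM
    obtain rfl : a = 2 := by omega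
    obtain rfl : b = 2 := by omega
    obtain rfl : c = 2 := by omega
    decide
  · have := le_sum_of_mem hd
    have := h2 d hd
    omega

lemma cycleWeight_smallCycleTypes : ∀ M ∈ smallCycleTypes,
    (M.sum ≤ 4 → M.cycleWeight ≤ 8) ∧ (5 ≤ M.sum → M.cycleWeight ≤ 2 * (M.sum - 2)!) ∧
      (M.sum = 5 → M.cycleWeight < 12) := by
  decide

lemma Multiset.cycleWeight_bound {M : Multiset ℕ} (h2 : ∀ a ∈ M, 2 ≤ a) :
    (M.sum ≤ 4 → M.cycleWeight ≤ 8) ∧ (5 ≤ M.sum → M.cycleWeight ≤ 2 * (M.sum - 2)!) ∧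
      (5 ≤ M.sum → M.sum ≠ 6 → M.cycleWeight < 2 * (M.sum - 2)!) := by
  induction M using Multiset.induction with
  | empty => decide
  | cons a M ih =>
    rcases Nat.lt_or_ge 6 (a ::ₘ M).sum with h6 | h6
    · suffices h : (a ::ₘ M).cycleWeight < 2 * ((a ::ₘ M).sum - 2)! from
        ⟨by omega, fun _ => h.le, fun _ _ => h⟩
      have h3 := cycleWeight_cons_le a M
      rw [forall_mem_cons] at h2
      obtain ⟨ha, h2⟩ := h2
      specialize ih h2
      have hs := sum_cons a M
      obtain ⟨k, hk⟩ : ∃ k, (a ::ₘ M).sum = k + 7 := ⟨_, (Nat.sub_add_cancel h6).symm⟩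
      rw [hk] at h3 hs ⊢
      rw [show k + 7 - 2 = (k + 4) + 1 by omega, factorial_succ, show k + 4 = (k + 3) + 1 by omega,
        factorial_succ]
      have h4 : 6 ≤ (k + 3)! := factorial_le (m := 3) (by omega)
      have h5 : M.cycleWeight ≤ 2 * (k + 3)! := by
        rcases Nat.lt_or_ge 4 M.sum with h | h
        · exact (ih.2.1 h).trans (Nat.mul_le_mul_left 2 (factorial_le (by omega)))
        · exact (ih.1 h).trans (by omega)
      have h7 : k + 7 < (k + 3 + 1 + 1) * (k + 3 + 1) := by nlinarith
      calc _ ≤ _ := h3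
        _ ≤ 2 * (k + 3)! * (k + 7) := Nat.mul_le_mul_right _ h5
        _ < 2 * (k + 3)! * ((k + 3 + 1 + 1) * (k + 3 + 1)) := by gcongr
        _ = _ := by ring
    · obtain ⟨w1, w2, w3⟩ := cycleWeight_smallCycleTypes _ (mem_smallCycleTypes h2 h6)
      refine ⟨w1, w2, fun h5 h6' => ?_⟩
      have h : (a ::ₘ M).sum = 5 := by omega
      rw [h]
      exact w3 h

lemma Multiset.factorial_mul_cycleWeight_lt {M : Multiset ℕ} (h2 : ∀ a ∈ M, 2 ≤ a) {n : ℕ}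
    (hn : 5 ≤ n) (hn6 : n ≠ 6) (hM : M.sum ≤ n) (h0 : M ≠ 0) (hs : M ≠ {2}) :
    (n - M.sum)! * M.cycleWeight < 2 * (n - 2)! := by
  have hb := cycleWeight_bound h2
  rcases Nat.lt_or_ge 4 M.sum with h | h
  · have h3 : (n - M.sum)! * (M.sum - 2)! ≤ (n - 2)! := by
      have := factorial_mul_factorial_dvd_factorial_add (n - M.sum) (M.sum - 2)
      rw [show n - M.sum + (M.sum - 2) = n - 2 by omega] at this
      exact Nat.le_of_dvd (factorial_pos _) this
    by_cases h6 : M.sum = 6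
    · have h4 : (n - M.sum)! * (M.sum - 2)! < (n - 2)! := by
        rw [h6]
        obtain ⟨k, rfl⟩ : ∃ k, n = k + 7 := ⟨n - 7, by omega⟩
        rw [show k + 7 - 6 = k + 1 by omega, show k + 7 - 2 = (k + 1) + 4 by omega]
        have h5 : 24 < (k + 1 + 3 + 1) * ((k + 1 + 2 + 1) * ((k + 1 + 1 + 1) * (k + 1 + 1))) :=
          calc 24 < 5 * (4 * (3 * 2)) := by norm_num
            _ ≤ _ := by gcongr <;> omega
        have h7 := Nat.mul_lt_mul_of_pos_right h5 (factorial_pos (k + 1))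
        rw [factorial_succ (k + 1 + 3), factorial_succ (k + 1 + 2), factorial_succ (k + 1 + 1),
          factorial_succ (k + 1), show (6 - 2)! = 24 from rfl]
        linarith
      have := Nat.mul_le_mul_left (n - M.sum)! (hb.2.1 h)
      linarith
    · have := Nat.mul_lt_mul_of_pos_left (hb.2.2 h h6) (factorial_pos (n - M.sum))
      linarith
  · have hmem := mem_smallCycleTypes h2 (by omega)
    have key : ∀ M ∈ smallCycleTypes, M.sum ≤ 4 → M ≠ 0 → M ≠ {2} →
      M.sum = 3 ∧ M.cycleWeight ≤ 3 ∨ M.sum = 4 ∧ M.cycleWeight ≤ 8 := by decide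
    obtain ⟨k, rfl⟩ : ∃ k, n = k + 5 := ⟨n - 5, by omega⟩
    have h4 := factorial_pos k
    rcases key M hmem h h0 hs with ⟨e, hw⟩ | ⟨e, hw⟩ <;> rw [e]
    · rw [show k + 5 - 3 = (k + 1) + 1 by omega, show k + 5 - 2 = ((k + 1) + 1) + 1 by omega,
        factorial_succ (k + 1 + 1)]
      have h5 := factorial_pos (k + 1 + 1)
      have := Nat.mul_le_mul_left (k + 1 + 1)! hw
      nlinarith
    · rw [show k + 5 - 4 = k + 1 by omega, show k + 5 - 2 = ((k + 1) + 1) + 1 by omega,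
        factorial_succ (k + 1 + 1), factorial_succ (k + 1)]
      have h5 := factorial_pos (k + 1)
      have := Nat.mul_le_mul_left (k + 1)! hw
      have h6 : 6 ≤ (k + 1 + 1 + 1) * (k + 1 + 1) := by nlinarith
      have := Nat.mul_le_mul_right (k + 1)! h6
      linarith

end ClassSizes

section SymmetricGroups

open Multiset Nat

variable {α : Type} [Fintype α] [DecidableEq α]
  {σ : Equiv.Perm {f : Perm α → ℂ // IsIrrChar (Perm α) f}}
  {τ : Equiv.Perm (ConjClasses (Perm α))} {t : Perm α → Perm α}

lemma IsTableAut.factorial_mul_cycleWeight_eq (h : IsTableAut (Perm α) σ τ)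
    (ht : ∀ g, ConjClasses.mk (t g) = τ (ConjClasses.mk g)) (g : Perm α) :
    (Fintype.card α - (t g).cycleType.sum)! * (t g).cycleType.cycleWeight =
      (Fintype.card α - g.cycleType.sum)! * g.cycleType.cycleWeight := by
  have h1 := Equiv.Perm.card_isConj_mul_eq (t g)
  have h2 := Equiv.Perm.card_isConj_mul_eq g
  rw [← h.card_isConj ht] at h2
  have h3 : 0 < Nat.card {k : Perm α | IsConj (t g) k} := by
    have : Nonempty {k : Perm α | IsConj (t g) k} := ⟨⟨t g, IsConj.refl _⟩⟩
    exact Nat.card_pos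
  have h4 := Nat.eq_of_mul_eq_mul_left h3 (h1.trans h2.symm)
  rwa [mul_assoc, mul_assoc] at h4

lemma Equiv.Perm.sum_cycleType_le_card (g : Perm α) : g.cycleType.sum ≤ Fintype.card α := by
  rw [Equiv.Perm.sum_cycleType]
  exact Finset.card_le_univ _

lemma IsTableAut.map_one_of_card (h : IsTableAut (Perm α) σ τ)
    (ht : ∀ g, ConjClasses.mk (t g) = τ (ConjClasses.mk g)) (hn : 5 ≤ Fintype.card α)
    (hn6 : Fintype.card α ≠ 6) : t 1 = 1 := by
  have h1 := h.factorial_mul_cycleWeight_eq ht 1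
  have h2 : 2 * (Fintype.card α - 2)! < (Fintype.card α)! := by
    obtain ⟨k, hk⟩ : ∃ k, Fintype.card α = k + 5 := ⟨_, (Nat.sub_add_cancel hn).symm⟩
    rw [hk, show k + 5 - 2 = k + 3 by omega, factorial_succ (k + 4), factorial_succ (k + 3)]
    have := factorial_pos (k + 3)
    have h3 : 2 < (k + 4 + 1) * (k + 3 + 1) := by nlinarith
    have := Nat.mul_lt_mul_of_pos_right h3 this
    linarith
  have h3 : (0 : Multiset ℕ).cycleWeight = 1 := by decide
  rw [Equiv.Perm.cycleType_one, h3, sum_zero, Nat.sub_zero, mul_one] at h1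
  rw [← Equiv.Perm.cycleType_eq_zero]
  by_contra h0
  by_cases hs : (t 1).cycleType = {2}
  · rw [hs, sum_singleton, show ({2} : Multiset ℕ).cycleWeight = 2 by decide] at h1
    omega
  · have := factorial_mul_cycleWeight_lt (fun a => Equiv.Perm.two_le_of_mem_cycleType) hn hn6
      (Equiv.Perm.sum_cycleType_le_card (t 1)) h0 hs
    omega

lemma IsTableAut.isConj_swap_of_card (h : IsTableAut (Perm α) σ τ)
    (ht : ∀ g, ConjClasses.mk (t g) = τ (ConjClasses.mk g)) (hn : 5 ≤ Fintype.card α)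
    (hn6 : Fintype.card α ≠ 6) (x y : α) (hxy : x ≠ y) :
    IsConj (t (Equiv.swap x y)) (Equiv.swap x y) := by
  have h1 := h.factorial_mul_cycleWeight_eq ht (Equiv.swap x y)
  have hc : (Equiv.swap x y).cycleType = {2} :=
     Equiv.Perm.isSwap_iff_cycleType.mp (Equiv.Perm.swap_isSwap_iff.mpr hxy)
  rw [hc, sum_singleton, show ({2} : Multiset ℕ).cycleWeight = 2 by decide] at h1
  rw [Equiv.Perm.isConj_iff_cycleType_eq, hc]
  by_contra hs
  refine (factorial_mul_cycleWeight_lt (fun a => Equiv.Perm.two_le_of_mem_cycleType) hn hn6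
    (Equiv.Perm.sum_cycleType_le_card (t (Equiv.swap x y))) ?_ hs).ne (by linarith)
  intro h0
  have h2 := (isConj_lift_iff ht (a := 1) (b := Equiv.swap x y))
  rw [h.map_one_of_card ht hn hn6, isConj_one_right, isConj_one_right,
    ← Equiv.Perm.cycleType_eq_zero, h0, ← Equiv.Perm.cycleType_eq_zero, hc] at h2
  exact absurd (h2.mp rfl) (by decide)

lemma IsTableAut.orderOf_eq_of_card_eq (h : IsTableAut (Perm α) σ τ)
    (ht : ∀ g, ConjClasses.mk (t g) = τ (ConjClasses.mk g))
    (hn : Fintype.card α = 3 ∨ Fintype.card α = 6) (g : Perm α) : orderOf (t g) = orderOf g := by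
  have h1 := h.factorial_mul_cycleWeight_eq ht g
  have h2 := Equiv.Perm.sum_cycleType_le_card g
  have h3 := Equiv.Perm.sum_cycleType_le_card (t g)
  have hM := mem_smallCycleTypes (fun a => Equiv.Perm.two_le_of_mem_cycleType (σ := g)) (by omega)
  have hM' := mem_smallCycleTypes (fun a => Equiv.Perm.two_le_of_mem_cycleType (σ := t g))
    (by omega)
  rw [← Equiv.Perm.lcm_cycleType, ← Equiv.Perm.lcm_cycleType]
  generalize g.cycleType = M at *
  generalize (t g).cycleType = M' at *
  have key : ∀ n ∈ [3, 6], ∀ M ∈ smallCycleTypes, ∀ M' ∈ smallCycleTypes, M.sum ≤ n → M'.sum ≤ n →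
    (n - M'.sum)! * M'.cycleWeight = (n - M.sum)! * M.cycleWeight → M'.lcm = M.lcm := by
    decide
  exact key _ (by simpa using hn) M hM M' hM' h2 h3 h1

end SymmetricGroups

section DegreeTwo

variable {σ : Equiv.Perm {f : Perm (Fin 2) → ℂ // IsIrrChar (Perm (Fin 2)) f}}
  {τ : Equiv.Perm (ConjClasses (Perm (Fin 2)))} {t : Perm (Fin 2) → Perm (Fin 2)}

lemma IsTableAut.map_one_of_two (h : IsTableAut (Perm (Fin 2)) σ τ)
    (ht : ∀ g, ConjClasses.mk (t g) = τ (ConjClasses.mk g)) : t 1 = 1 := by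
  by_contra h1
  have key : ∀ φ ∈ Submodule.span ℂ {f | IsIrrChar (Perm (Fin 2)) f}, φ (t 1) = φ 1 := by
    intro φ hφ
    induction hφ using Submodule.span_induction with
    | mem f hf =>
      have hs : t 1 = swap 0 1 := by
        have : ∀ a : Perm (Fin 2), a ≠ 1 → a = swap 0 1 := by decide
        exact this _ h1
      have e := IsIrrChar.mul_sum_swap hf (t 1)
      obtain ⟨m, hm, hfm⟩ := hf.exists_one_eq_natCast
      obtain ⟨k, hk, hfk⟩ := (h.isIrrChar_comp ht hf).exists_one_eq_natCast
      rw [Function.comp_apply] at hfk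
      have e1 : (swap 0 0 : Perm (Fin 2)) = 1 := by decide
      have e2 : (swap 1 1 : Perm (Fin 2)) = 1 := by decide
      have e3 : (swap 1 0 : Perm (Fin 2)) = swap 0 1 := by decide
      have e4 : (swap 0 1 * swap 0 1 : Perm (Fin 2)) = 1 := by decide
      rw [hs] at hfk e ⊢
      simp only [Fin.sum_univ_two, e1, e2, e3, e4, mul_one] at e
      rw [hfk, hfm] at e ⊢
      norm_cast at e ⊢
      have : k * k = m * m := by linarith
      exact Nat.mul_self_inj.mp this
    | zero => rfl
    | add f f' _ _ h1 h2 => simp [h1, h2]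
    | smul c f _ h1 => simp [h1]
  have h2 := key (fun g => if g = 1 then 1 else 0)
    (mem_span_isIrrChar _ fun g k => by simp only [conj_eq_one_iff])
  simp [h1] at h2

lemma IsTableAut.isConj_swap_of_two (h : IsTableAut (Perm (Fin 2)) σ τ)
    (ht : ∀ g, ConjClasses.mk (t g) = τ (ConjClasses.mk g)) (x y : Fin 2) (hxy : x ≠ y) :
    IsConj (t (swap x y)) (swap x y) := by
  have h2 := isConj_lift_iff ht (a := 1) (b := swap x y)
  rw [h.map_one_of_two ht, isConj_one_right, isConj_one_right] at h2
  have h3 : swap x y ≠ 1 := by rwa [Ne, Equiv.swap_eq_one_iff]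
  have : ∀ a b : Perm (Fin 2), a ≠ 1 → b ≠ 1 → a = b := by decide
  rw [this _ _ (fun h => h3 (h2.mp h)) h3]

end DegreeTwo

theorem table_aut_symmetricGroup_preserves_order (n : ℕ) (h4 : n ≠ 4)
    (σ : Equiv.Perm {f : Equiv.Perm (Fin n) → ℂ // IsIrrChar (Equiv.Perm (Fin n)) f})
    (τ : Equiv.Perm (ConjClasses (Equiv.Perm (Fin n))))
    (h : IsTableAut (Equiv.Perm (Fin n)) σ τ) :
    ∀ g h' : Equiv.Perm (Fin n),
      ConjClasses.mk h' = τ (ConjClasses.mk g) → orderOf h' = orderOf g := by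
  intro g h' hgh
  choose t ht using fun g : Perm (Fin n) => ConjClasses.mk_surjective (τ (ConjClasses.mk g))
  have hconj : IsConj h' (t g) := ConjClasses.mk_eq_mk_iff_isConj.mp (hgh.trans (ht g).symm)
  obtain ⟨k, hk⟩ := isConj_iff.mp hconj
  suffices hord : orderOf (t g) = orderOf g by
    rw [← hord, ← hk, ← MulAut.conj_apply, MulEquiv.orderOf_eq]
  rcases Nat.lt_or_ge n 5 with hn | hn
  · interval_cases n
    · rw [Subsingleton.elim (t g) g]
    · rw [Subsingleton.elim (t g) g]
    · exact h.orderOf_eq ht (h.map_one_of_two ht) (h.isConj_swap_of_two ht) g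
    · exact h.orderOf_eq_of_card_eq ht (Or.inl (Fintype.card_fin 3)) g
    · exact absurd rfl h4
  · by_cases hn6 : n = 6
    · exact h.orderOf_eq_of_card_eq ht (Or.inr ((Fintype.card_fin n).trans hn6)) g
    · have : Nonempty (Fin n) := ⟨⟨0, by omega⟩⟩
      rw [← Fintype.card_fin n] at hn hn6
      exact h.orderOf_eq ht (h.map_one_of_card ht hn hn6) (h.isConj_swap_of_card ht hn hn6) g
end

section
/- Let n ≥ 5 be a natural number. Then: (a) there exists a permutation g of Fin n such that (number of fixed points of g) − 1 = n − 3 (as integers); and (b) there is no permutation g of Fin n such that sign(g) · ((number of fixed points of g) − 1) = n − 3 (as integers), where sign(g) ∈ {1, −1} is the sign of the permutation g. (This says that of the two degree-(n−1) characters χ^{(n−1,1)}: g ↦ |Fix g| − 1 and χ^{(2,1^{n−2})}: g ↦ sgn(g)(|Fix g| − 1) of S_n, only the former takes n − 3 as a value.) -/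
theorem Equiv.Perm.natCard_fixed_add_card_support {α : Type*} [Fintype α] [DecidableEq α]
    (g : Equiv.Perm α) : Nat.card {x : α // g x = x} + g.support.card = Fintype.card α := by
  have h : Nat.card {x : α // g x = x} = (g.supportᶜ).card := by
    rw [Nat.card_eq_fintype_card, Fintype.card_subtype]
    congr 1
    ext x
    simp
  rw [h, Finset.card_compl_add_card]

/-- Of the two degree-`(n-1)` characters `g ↦ |Fix g| - 1` and
`g ↦ sgn(g)(|Fix g| - 1)` of `Sₙ` (`n ≥ 5`), only the former takes `n - 3` as a value. -/
theorem value_n_sub_three (n : ℕ) (hn : 5 ≤ n) :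
    (∃ g : Equiv.Perm (Fin n),
      (Nat.card {x : Fin n // g x = x} : ℤ) - 1 = (n : ℤ) - 3) ∧
    ¬ ∃ g : Equiv.Perm (Fin n),
      (Equiv.Perm.sign g : ℤ) * ((Nat.card {x : Fin n // g x = x} : ℤ) - 1) = (n : ℤ) - 3 := by
  constructor
  · have hne : (⟨0, by omega⟩ : Fin n) ≠ ⟨1, by omega⟩ := by simp
    refine ⟨Equiv.swap ⟨0, by omega⟩ ⟨1, by omega⟩, ?_⟩
    have h := Equiv.Perm.natCard_fixed_add_card_support
      (Equiv.swap (⟨0, by omega⟩ : Fin n) ⟨1, by omega⟩)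
    rw [Equiv.Perm.card_support_swap hne, Fintype.card_fin] at h
    omega
  · rintro ⟨g, hg⟩
    have h := g.natCard_fixed_add_card_support
    rw [Fintype.card_fin] at h
    rcases Int.units_eq_one_or (Equiv.Perm.sign g) with hs | hs
    · rw [hs, Units.val_one, one_mul] at hg
      have hswap : g.IsSwap := Equiv.Perm.card_support_eq_two.mp (by omega)
      rw [hswap.sign_eq] at hs
      exact absurd hs (by decide)
    · rw [hs, Units.val_neg, Units.val_one] at hg
      omega
end

section
/- Let g be a permutation of Fin n and let r be a natural number. Then the number of r-element subsets S of Fin n with g(S) = S (setwise) equals the number of finite sets T of orbits of the cyclic group generated by g acting on Fin n such that the sum of the cardinalities of the orbits in T equals r. -/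
section

variable {α : Type*} [DecidableEq α] {g : Equiv.Perm α} {S : Finset α}

theorem Finset.mem_iff_mem_of_orbitRel_of_image_eq (hS : S.image g = S) {x y : α}
    (h : MulAction.orbitRel (Subgroup.zpowers g) α x y) : x ∈ S ↔ y ∈ S := by
  open scoped Pointwise in
  have hle : Subgroup.zpowers g ≤ MulAction.stabilizer (Equiv.Perm α) S := by
    rw [Subgroup.zpowers_le]
    exact hS
  obtain ⟨⟨k, hk⟩, rfl⟩ := h
  have hkS := MulAction.mem_stabilizer_iff.mp (hle hk)
  change k • y ∈ S ↔ y ∈ S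
  conv_lhs => rw [← hkS]
  exact Finset.smul_mem_smul_finset_iff k

variable [Fintype α]

open scoped Classical in
/-- Finsets fixed setwise by `g` correspond to finsets of orbits of `⟨g⟩`. -/
noncomputable def Finset.fixedEquivOrbitSets (g : Equiv.Perm α) :
    {S : Finset α // S.image g = S} ≃
      Finset (MulAction.orbitRel.Quotient (Subgroup.zpowers g) α) where
  toFun S := S.1.image (Quotient.mk _)
  invFun T := ⟨Finset.univ.filter fun x => Quotient.mk _ x ∈ T, by
    refine Finset.eq_of_subset_of_card_le (fun y hy => ?_)
      (Finset.card_image_of_injective _ g.injective).ge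
    obtain ⟨x, hx, rfl⟩ := Finset.mem_image.mp hy
    have hgx : (Quotient.mk _ (g x) : MulAction.orbitRel.Quotient (Subgroup.zpowers g) α) =
        Quotient.mk _ x := Quotient.sound ⟨⟨g, Subgroup.mem_zpowers g⟩, rfl⟩
    simpa [hgx] using hx⟩
  left_inv S := by
    ext x
    simp only [Finset.mem_filter, Finset.mem_univ, true_and, Finset.mem_image]
    refine ⟨?_, fun hx => ⟨x, hx, rfl⟩⟩
    rintro ⟨y, hy, hyx⟩
    exact (Finset.mem_iff_mem_of_orbitRel_of_image_eq S.2 (Quotient.exact hyx)).mp hy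
  right_inv T := by
    ext o
    induction o using Quotient.inductionOn with
    | h x =>
      simp only [Finset.mem_filter, Finset.mem_univ, true_and, Finset.mem_image]
      exact ⟨fun ⟨y, hy, hyx⟩ => hyx ▸ hy, fun hx => ⟨x, hx, rfl⟩⟩

theorem Finset.card_fixedEquivOrbitSets_symm (g : Equiv.Perm α)
    (T : Finset (MulAction.orbitRel.Quotient (Subgroup.zpowers g) α)) :
    ((Finset.fixedEquivOrbitSets g).symm T).1.card = ∑ o ∈ T, Nat.card o.orbit := by
  classical
  change (Finset.univ.filter fun x => Quotient.mk _ x ∈ T).card = _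
  refine (Finset.card_eq_sum_card_fiberwise (f := Quotient.mk _) (t := T)
    fun x hx => (Finset.mem_filter.mp hx).2).trans ?_
  refine Finset.sum_congr rfl fun o ho => ?_
  rw [Nat.card_coe_set_eq, ← Set.ncard_coe_finset]
  congr 1
  ext x
  simp only [Finset.coe_filter, Finset.mem_filter, Finset.mem_univ, true_and, Set.mem_ofPred_eq,
    MulAction.orbitRel.Quotient.mem_orbit]
  exact ⟨fun h => h.2, fun h => ⟨by subst h; exact ho, h⟩⟩

end

/-- The number of `r`-element subsets of `Fin n` fixed setwise by a permutation `g`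
equals the number of finite sets of orbits of the cyclic group generated by `g`
whose cardinalities sum to `r`. -/
theorem card_fixed_subsets_eq_card_orbit_sets (n r : ℕ) (g : Equiv.Perm (Fin n)) :
    Nat.card {S : Finset (Fin n) // S.card = r ∧ S.image g = S} =
      Nat.card {T : Finset (MulAction.orbitRel.Quotient (Subgroup.zpowers g) (Fin n)) //
        ∑ o ∈ T, Nat.card o.orbit = r} := by
  refine Nat.card_congr (Equiv.trans ?_ ((Finset.fixedEquivOrbitSets g).subtypeEquiv
    (p := fun S => S.1.card = r) fun S => ?_))
  · exact (Equiv.subtypeEquivRight fun S => and_comm).trans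
      (Equiv.subtypeSubtypeEquivSubtypeInter (fun S : Finset (Fin n) => S.image g = S)
        fun S => S.card = r).symm
  · rw [← Finset.card_fixedEquivOrbitSets_symm, Equiv.symm_apply_apply]
end

section
/- Let g and h be permutations of Fin n. Suppose that for every natural number r with 1 ≤ r and 2r ≤ n, the number of r-element subsets of Fin n fixed setwise by g equals the number of r-element subsets of Fin n fixed setwise by h. Then g and h have the same cycle type (equivalently, g and h are conjugate in the symmetric group on Fin n). -/
open Polynomial

/-- The polynomial `∏ (1 + X ^ a)` over the elements `a` of a multiset. -/
noncomputable def subsetSumPoly (s : Multiset ℕ) : ℤ[X] := (s.map fun a => 1 + X ^ a).prod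

theorem coeff_subsetSumPoly {k : ℕ} (hk : 0 < k) (s : Multiset ℕ) (hs : ∀ a ∈ s, k ≤ a) :
    (subsetSumPoly s).coeff 0 = 1 ∧ (subsetSumPoly s).coeff k = s.count k := by
  induction s using Multiset.induction with
  | empty => simp [subsetSumPoly, coeff_one, hk.ne']
  | cons a s ih =>
    obtain ⟨h0, h1⟩ := ih fun b hb => hs b (Multiset.mem_cons_of_mem hb)
    have ha : k ≤ a := hs a (Multiset.mem_cons_self a s)
    have hrec : subsetSumPoly (a ::ₘ s) = subsetSumPoly s + X ^ a * subsetSumPoly s := by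
      simp [subsetSumPoly, add_mul]
    rw [hrec, coeff_add, coeff_add, coeff_X_pow_mul', coeff_X_pow_mul', h0, h1]
    rcases ha.eq_or_lt with rfl | hlt
    · simp [h0, hk.ne']
    · simp [hlt.not_ge, hlt.ne, (hk.trans hlt).ne']

theorem subsetSumPoly_ne_zero (s : Multiset ℕ) (hs : ∀ a ∈ s, 0 < a) : subsetSumPoly s ≠ 0 := by
  intro h
  have := (coeff_subsetSumPoly one_pos s hs).1
  simp [h] at this

theorem subsetSumPoly_add (s t : Multiset ℕ) :
    subsetSumPoly (s + t) = subsetSumPoly s * subsetSumPoly t := by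
  simp [subsetSumPoly]

theorem subsetSumPoly_injective {s t : Multiset ℕ} (hs : ∀ a ∈ s, 0 < a) (ht : ∀ a ∈ t, 0 < a)
    (h : subsetSumPoly s = subsetSumPoly t) : s = t := by
  ext k
  induction k using Nat.strong_induction_on with
  | _ k ih =>
    rcases k.eq_zero_or_pos with rfl | hk
    · rw [Multiset.count_eq_zero_of_notMem fun h => (hs 0 h).false,
        Multiset.count_eq_zero_of_notMem fun h => (ht 0 h).false]
    have hlow : s.filter (· < k) = t.filter (· < k) := by
      ext j
      rw [Multiset.count_filter, Multiset.count_filter]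
      split_ifs with hj
      · exact ih j hj
      · rfl
    have hhigh : subsetSumPoly (s.filter (¬ · < k)) = subsetSumPoly (t.filter (¬ · < k)) := by
      rw [← Multiset.filter_add_not (· < k) s, ← Multiset.filter_add_not (· < k) t,
        subsetSumPoly_add, subsetSumPoly_add, hlow] at h
      exact mul_left_cancel₀
        (subsetSumPoly_ne_zero _ fun a ha => ht a (Multiset.mem_of_mem_filter ha)) h
    have hcoeff : (subsetSumPoly (s.filter (¬ · < k))).coeff k =
        (subsetSumPoly (t.filter (¬ · < k))).coeff k := by rw [hhigh]
    rw [(coeff_subsetSumPoly hk _ fun a ha => not_lt.1 (Multiset.mem_filter.1 ha).2).2,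
      (coeff_subsetSumPoly hk _ fun a ha => not_lt.1 (Multiset.mem_filter.1 ha).2).2] at hcoeff
    simpa [Multiset.count_filter] using hcoeff

namespace Equiv.Perm

variable {α : Type*} [Fintype α] [DecidableEq α]

/-- The finset of all orbits of a permutation, fixed points included. -/
def orbitFinset (g : Perm α) : Finset (Finset α) :=
  Finset.univ.image fun x => Finset.univ.filter (g.SameCycle x)

/-- The finset of all subsets fixed setwise by a permutation. -/
def fixedSubsets (g : Perm α) : Finset (Finset α) :=
  Finset.univ.filter fun S => S.image g = S

theorem mem_orbitFinset {g : Perm α} {p : Finset α} :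
    p ∈ g.orbitFinset ↔ ∃ x, ∀ y, y ∈ p ↔ g.SameCycle x y := by
  simp only [orbitFinset, Finset.mem_image, Finset.mem_univ, true_and, Finset.ext_iff,
    Finset.mem_filter]
  exact exists_congr fun x => forall_congr' fun y => Iff.comm

theorem sameCycle_iff_mem_of_mem_orbitFinset {g : Perm α} {p : Finset α} (hp : p ∈ g.orbitFinset)
    {x : α} (hx : x ∈ p) (y : α) : g.SameCycle x y ↔ y ∈ p := by
  obtain ⟨z, hz⟩ := mem_orbitFinset.1 hp
  rw [hz] at hx ⊢
  exact ⟨hx.trans, hx.symm.trans⟩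

theorem nonempty_of_mem_orbitFinset {g : Perm α} {p : Finset α} (hp : p ∈ g.orbitFinset) :
    p.Nonempty := by
  obtain ⟨z, hz⟩ := mem_orbitFinset.1 hp
  exact ⟨z, (hz z).2 (SameCycle.refl g z)⟩

theorem eq_of_mem_orbitFinset {g : Perm α} {p q : Finset α} (hp : p ∈ g.orbitFinset)
    (hq : q ∈ g.orbitFinset) {x : α} (hxp : x ∈ p) (hxq : x ∈ q) : p = q := by
  ext y
  rw [← sameCycle_iff_mem_of_mem_orbitFinset hp hxp, sameCycle_iff_mem_of_mem_orbitFinset hq hxq]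

theorem image_eq_self_iff_sameCycle {g : Perm α} {S : Finset α} :
    S.image g = S ↔ ∀ x ∈ S, ∀ y, g.SameCycle x y → y ∈ S := by
  constructor
  · intro h x hx y hxy
    obtain ⟨i, -, rfl⟩ := hxy.exists_pow_eq'
    clear hxy
    induction i with
    | zero => simpa using hx
    | succ i ih =>
      rw [pow_succ', mul_apply, ← h]
      exact Finset.mem_image_of_mem g ih
  · intro h
    refine Finset.eq_of_subset_of_card_le ?_ (Finset.card_image_of_injective S g.injective).ge
    exact Finset.image_subset_iff.2 fun x hx => h x hx _ (sameCycle_apply_right.2 (.refl g x))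

theorem sum_fixedSubsets (g : Perm α) :
    ∑ S ∈ g.fixedSubsets, (X ^ S.card : ℤ[X]) =
      subsetSumPoly (g.orbitFinset.val.map Finset.card) := by
  rw [subsetSumPoly, Multiset.map_map]
  change _ = ∏ p ∈ g.orbitFinset, (1 + X ^ p.card)
  rw [Finset.prod_one_add]
  symm
  refine Finset.sum_nbij' (fun T => T.biUnion id) (fun S => g.orbitFinset.filter (· ⊆ S))
    ?_ ?_ ?_ ?_ ?_
  · intro T hT
    rw [Finset.mem_powerset] at hT
    rw [fixedSubsets, Finset.mem_filter, image_eq_self_iff_sameCycle]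
    simp only [Finset.mem_univ, true_and, Finset.mem_biUnion, id]
    rintro x ⟨p, hp, hx⟩ y hxy
    exact ⟨p, hp, (sameCycle_iff_mem_of_mem_orbitFinset (hT hp) hx y).1 hxy⟩
  · intro S _
    exact Finset.mem_powerset.2 (Finset.filter_subset _ _)
  · intro T hT
    rw [Finset.mem_powerset] at hT
    ext p
    simp only [Finset.mem_filter]
    constructor
    · rintro ⟨hp, hpT⟩
      obtain ⟨x, hx⟩ := nonempty_of_mem_orbitFinset hp
      obtain ⟨q, hq, hxq⟩ := Finset.mem_biUnion.1 (hpT hx)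
      rwa [eq_of_mem_orbitFinset hp (hT hq) hx hxq]
    · exact fun hp => ⟨hT hp, Finset.subset_biUnion_of_mem id hp⟩
  · intro S hS
    rw [fixedSubsets, Finset.mem_filter, image_eq_self_iff_sameCycle] at hS
    ext x
    simp only [Finset.mem_biUnion, Finset.mem_filter, id]
    constructor
    · rintro ⟨p, ⟨-, hpS⟩, hx⟩
      exact hpS hx
    · intro hx
      refine ⟨Finset.univ.filter (g.SameCycle x),
        ⟨Finset.mem_image_of_mem _ (Finset.mem_univ x), fun y hy => ?_⟩, ?_⟩
      · exact hS.2 x hx y (Finset.mem_filter.1 hy).2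
      · simp [SameCycle.refl]
  · intro T hT
    rw [Finset.mem_powerset] at hT
    rw [Finset.card_biUnion, Finset.prod_pow_eq_pow_sum]
    · rfl
    · intro p hp q hq hpq
      exact Finset.disjoint_left.2 fun x hxp hxq =>
        hpq (eq_of_mem_orbitFinset (hT hp) (hT hq) hxp hxq)

theorem orbitFinset_filter_one_lt_card (g : Perm α) :
    g.orbitFinset.filter (1 < ·.card) = g.cycleFactorsFinset.image support := by
  ext p
  rw [Finset.mem_filter, Finset.mem_image]
  constructor
  · rintro ⟨hp, hcard⟩
    obtain ⟨x, hx⟩ := mem_orbitFinset.1 hp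
    obtain ⟨y, hy, hyx⟩ := Finset.exists_mem_ne hcard x
    have hxs : x ∈ g.support := by
      rw [mem_support]
      intro hfix
      exact hyx (((hx y).1 hy).eq_of_left hfix).symm
    refine ⟨g.cycleOf x, cycleOf_mem_cycleFactorsFinset_iff.2 hxs, ?_⟩
    ext z
    rw [mem_support_cycleOf_iff, hx]
    exact and_iff_left hxs
  · rintro ⟨c, hc, rfl⟩
    have hcyc := (mem_cycleFactorsFinset_iff.1 hc).1
    refine ⟨mem_orbitFinset.2 ?_, hcyc.two_le_card_support⟩
    obtain ⟨x, hx⟩ := hcyc.nonempty_support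
    refine ⟨x, fun z => ?_⟩
    rw [cycle_is_cycleOf hx hc, mem_support_cycleOf_iff]
    exact and_iff_left (mem_cycleFactorsFinset_support_le hc hx)

theorem cycleType_eq_filter_card_orbitFinset (g : Perm α) :
    g.cycleType = (g.orbitFinset.val.map Finset.card).filter (1 < ·) := by
  have hinj : Set.InjOn (support : Perm α → Finset α) g.cycleFactorsFinset := by
    intro c hc d hd hcd
    obtain ⟨x, hx⟩ := (mem_cycleFactorsFinset_iff.1 hc).1.nonempty_support
    rw [cycle_is_cycleOf hx hc, cycle_is_cycleOf (hcd ▸ hx) hd]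
  have hval := congrArg Finset.val (orbitFinset_filter_one_lt_card g)
  rw [Finset.image_val_of_injOn hinj, Finset.filter_val] at hval
  rw [Multiset.filter_map, cycleType_def, ← Multiset.map_map, ← hval]
  rfl

theorem coeff_sum_fixedSubsets (g : Perm α) (r : ℕ) :
    (∑ S ∈ g.fixedSubsets, (X ^ S.card : ℤ[X])).coeff r =
      Nat.card {S : Finset α // S.card = r ∧ S.image g = S} := by
  rw [Nat.card_eq_fintype_card, Fintype.card_subtype, finsetSum_coeff]
  simp only [coeff_X_pow, Finset.sum_boole, fixedSubsets, Finset.filter_filter]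
  congr 2
  ext S
  simp [and_comm, eq_comm]

theorem card_fixed_subsets_compl (g : Perm α) {r : ℕ} (hr : r ≤ Fintype.card α) :
    Nat.card {S : Finset α // S.card = Fintype.card α - r ∧ S.image g = S} =
      Nat.card {S : Finset α // S.card = r ∧ S.image g = S} := by
  refine Nat.card_congr ((compl_involutive (α := Finset α)).toPerm.subtypeEquiv fun S => ?_)
  have hS := S.card_le_univ
  have himage : Sᶜ.image g = (S.image g)ᶜ := by
    apply Finset.coe_injective
    push_cast
    exact Set.image_compl_eq g.bijective
  rw [Function.Involutive.coe_toPerm, Finset.card_compl, himage, compl_inj_iff]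
  exact and_congr_left fun _ => by omega

end Equiv.Perm

/-- If two permutations of `Fin n` fix the same number of `r`-element subsets setwise
for every `r` with `1 ≤ r` and `2r ≤ n`, then they have the same cycle type. -/
theorem cycleType_eq_of_card_fixed_subsets_eq (n : ℕ) (g h : Equiv.Perm (Fin n))
    (H : ∀ r : ℕ, 1 ≤ r → 2 * r ≤ n →
      Nat.card {S : Finset (Fin n) // S.card = r ∧ S.image g = S} =
        Nat.card {S : Finset (Fin n) // S.card = r ∧ S.image h = S}) :
    g.cycleType = h.cycleType := by
  have hlow : ∀ r : ℕ, 2 * r ≤ n →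
      Nat.card {S : Finset (Fin n) // S.card = r ∧ S.image g = S} =
        Nat.card {S : Finset (Fin n) // S.card = r ∧ S.image h = S} := by
    intro r hr
    rcases r.eq_zero_or_pos with rfl | hpos
    · refine Nat.card_congr (Equiv.subtypeEquivRight fun S => and_congr_right fun hS => ?_)
      simp [Finset.card_eq_zero.1 hS]
    · exact H r hpos hr
  have hall : ∀ r : ℕ, Nat.card {S : Finset (Fin n) // S.card = r ∧ S.image g = S} =
      Nat.card {S : Finset (Fin n) // S.card = r ∧ S.image h = S} := by
    intro r
    rcases le_or_gt r n with hr | hr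
    · rcases le_or_gt (2 * r) n with h2 | h2
      · exact hlow r h2
      · have hr' : r ≤ Fintype.card (Fin n) := by simpa using hr
        rw [← g.card_fixed_subsets_compl hr', ← h.card_fixed_subsets_compl hr', Fintype.card_fin]
        exact hlow (n - r) (by omega)
    · refine Nat.card_congr (Equiv.subtypeEquivRight fun S => and_congr_right fun hS => ?_)
      have := S.card_le_univ
      rw [Fintype.card_fin] at this
      omega
  have hpos (k : Equiv.Perm (Fin n)) : ∀ a ∈ k.orbitFinset.val.map Finset.card, 0 < a := by
    intro a ha
    obtain ⟨p, hp, rfl⟩ := Multiset.mem_map.1 ha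
    exact (Equiv.Perm.nonempty_of_mem_orbitFinset hp).card_pos
  have hpoly : subsetSumPoly (g.orbitFinset.val.map Finset.card) =
      subsetSumPoly (h.orbitFinset.val.map Finset.card) := by
    rw [← g.sum_fixedSubsets, ← h.sum_fixedSubsets]
    ext r
    rw [g.coeff_sum_fixedSubsets, h.coeff_sum_fixedSubsets, hall r]
  rw [g.cycleType_eq_filter_card_orbitFinset, h.cycleType_eq_filter_card_orbitFinset,
    subsetSumPoly_injective (hpos g) (hpos h) hpoly]
end
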